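/- There exist constants c > 0 and C ≥ 0 such that every finite set A of complex numbers with |A| ≥ 2 contains a bi-Sidon subset S ⊆ A with |S| ≥ c · |A|^{5/12} · (log |A|)^{−C}. -/

import Mathlib

/-- A set is additive Sidon if all pairwise sums are distinct. -/
def IsAddSidon {α : Type*} [Add α] (S : Set α) : Prop :=
  ∀ a ∈ S, ∀ b ∈ S, ∀ a' ∈ S, ∀ b' ∈ S, a + b = a' + b' → ({a, b} : Set α) = {a', b'}

/-- A set is multiplicative Sidon if all pairwise products are distinct. -/
def IsMulSidon {α : Type*} [Mul α] (S : Set α) : Prop :=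
  ∀ a ∈ S, ∀ b ∈ S, ∀ a' ∈ S, ∀ b' ∈ S, a * b = a' * b' → ({a, b} : Set α) = {a', b'}

/-- A set is bi-Sidon if it is both additive and multiplicative Sidon. -/
def IsBiSidon {α : Type*} [Add α] [Mul α] (S : Set α) : Prop :=
  IsAddSidon S ∧ IsMulSidon S

section Auxiliary

open Finset

lemma sector_aux {p q r s : ℝ} (hp : 0 ≤ p) (hq : 0 ≤ q) (hr : 0 ≤ r) (hs : 0 ≤ s)
    (hqp : q ≤ p) (hsr : s ≤ r) (h1 : 2 * (p * r + q * s) ≤ p ^ 2 + q ^ 2)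
    (h2 : 2 * (p * r + q * s) ≤ r ^ 2 + s ^ 2) : p = 0 ∨ r = 0 := by
  wlog hpr : p ≤ r generalizing p q r s
  · exact (this hr hs hp hq hsr hqp (by linarith) (by linarith) (by linarith)).symm
  left
  by_contra hne
  have hp0 : 0 < p := lt_of_le_of_ne hp (Ne.symm hne)
  have hqq : q ^ 2 ≤ p ^ 2 := by gcongr
  have hqs : 0 ≤ q * s := by positivity
  have e1 : p * r ≤ p * p := by nlinarith
  have e2 : r ≤ p := le_of_mul_le_mul_left e1 hp0
  have e3 : r = p := le_antisymm e2 hpr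
  subst e3
  have e4 : q * s = 0 := by nlinarith
  have e5 : q = r := by nlinarith
  have e6 : s = 0 := by
    rcases mul_eq_zero.1 e4 with h | h
    · linarith
    · exact h
  subst e6
  nlinarith

lemma norm_sub_le_of_sector {w v : ℂ} (hre : 0 ≤ w.re ↔ 0 ≤ v.re) (him : 0 ≤ w.im ↔ 0 ≤ v.im)
    (hri : |w.im| ≤ |w.re| ↔ |v.im| ≤ |v.re|) (hw : ‖w‖ ≤ ‖w - v‖) (hv : ‖v‖ ≤ ‖w - v‖) :
    w = 0 ∨ v = 0 := by
  have hw2 : w.re ^ 2 + w.im ^ 2 ≤ (w.re - v.re) ^ 2 + (w.im - v.im) ^ 2 := by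
    have := pow_le_pow_left₀ (norm_nonneg _) hw 2
    rw [← Complex.normSq_eq_norm_sq, ← Complex.normSq_eq_norm_sq, Complex.normSq_apply,
      Complex.normSq_apply] at this
    simp only [Complex.sub_re, Complex.sub_im] at this
    nlinarith
  have hv2 : v.re ^ 2 + v.im ^ 2 ≤ (w.re - v.re) ^ 2 + (w.im - v.im) ^ 2 := by
    have := pow_le_pow_left₀ (norm_nonneg _) hv 2
    rw [← Complex.normSq_eq_norm_sq, ← Complex.normSq_eq_norm_sq, Complex.normSq_apply,
      Complex.normSq_apply] at this
    simp only [Complex.sub_re, Complex.sub_im] at this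
    nlinarith
  have same : ∀ a b : ℝ, (0 ≤ a ↔ 0 ≤ b) → |a| * |b| = a * b := by
    intro a b h
    rcases le_or_gt 0 a with ha | ha
    · rw [abs_of_nonneg ha, abs_of_nonneg (h.1 ha)]
    · have hb : b < 0 := by
        by_contra hb
        exact absurd (h.2 (not_lt.1 hb)) (not_le.2 ha)
      rw [abs_of_neg ha, abs_of_neg hb]
      ring
  have s1 := same _ _ hre
  have s2 := same _ _ him
  have a1 := sq_abs w.re
  have a2 := sq_abs w.im
  have a3 := sq_abs v.re
  have a4 := sq_abs v.im
  by_cases h : |w.im| ≤ |w.re|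
  · have h' := hri.1 h
    rcases sector_aux (abs_nonneg _) (abs_nonneg _) (abs_nonneg _) (abs_nonneg _) h h'
      (by nlinarith) (by nlinarith) with h0 | h0
    · left
      rw [h0] at h
      exact Complex.ext (abs_eq_zero.1 h0) (abs_eq_zero.1 (le_antisymm h (abs_nonneg _)))
    · right
      rw [h0] at h'
      exact Complex.ext (abs_eq_zero.1 h0) (abs_eq_zero.1 (le_antisymm h' (abs_nonneg _)))
  · have h' : ¬ |v.im| ≤ |v.re| := fun hh => h (hri.2 hh)
    push Not at h h'
    rcases sector_aux (abs_nonneg _) (abs_nonneg _) (abs_nonneg _) (abs_nonneg _) h.le h'.le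
      (by nlinarith) (by nlinarith) with h0 | h0
    · rw [h0] at h
      exact absurd h (not_lt.2 (abs_nonneg _))
    · rw [h0] at h'
      exact absurd h' (not_lt.2 (abs_nonneg _))

/-- A point lies in boundedly many discs whose radii are at most the distance from their centre
to the nearest other centre. -/
lemma card_discs_containing_le (T : Finset ℂ) (ρ : ℂ → ℝ)
    (hρ : ∀ y ∈ T, ∀ y' ∈ T, y ≠ y' → ρ y ≤ ‖y' - y‖) (z : ℂ) :
    #{y ∈ T | ‖z - y‖ ≤ ρ y} ≤ 16 := by
  let σ : ℂ → Bool × Bool × Bool × Bool := fun y =>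
    (decide (y - z = 0), decide (0 ≤ (y - z).re), decide (0 ≤ (y - z).im),
      decide (|(y - z).im| ≤ |(y - z).re|))
  have hcard : #(univ : Finset (Bool × Bool × Bool × Bool)) = 16 := by decide
  rw [← hcard]
  refine card_le_card_of_injOn σ (fun _ _ => mem_coe.2 (mem_univ _)) ?_
  intro y hy y' hy' h
  simp only [coe_filter, Set.mem_ofPred_eq] at hy hy'
  simp only [σ, Prod.mk.injEq, decide_eq_decide] at h
  obtain ⟨h0, h1, h2, h3⟩ := h
  by_contra hne
  have e : (y - z) - (y' - z) = y - y' := by ring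
  have := norm_sub_le_of_sector h1 h2 h3
    (by rw [e, norm_sub_rev y z, norm_sub_rev y y']; exact hy.2.trans (hρ y hy.1 y' hy'.1 hne))
    (by rw [e, norm_sub_rev y' z]; exact hy'.2.trans (hρ y' hy'.1 y hy.1 (Ne.symm hne)))
  have hz : y - z = 0 ∧ y' - z = 0 := by tauto
  exact hne (sub_left_inj.1 (hz.1.trans hz.2.symm))

/-- Ordered pairs of distinct points of `Y` such that the second is among the roughly
`64 |Y| / s` points nearest to the first. -/
noncomputable def closePairs (Y : Finset ℂ) (s : ℕ) : Finset (ℂ × ℂ) :=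
  {q ∈ Y ×ˢ Y | #{z ∈ Y | ‖z - q.1‖ ≤ ‖q.2 - q.1‖} * s ≤ 64 * #Y}

lemma card_closePairs_mul_le (Y : Finset ℂ) (s : ℕ) : #(closePairs Y s) * s ≤ 64 * #Y ^ 2 := by
  have h : #(closePairs Y s) =
      ∑ y ∈ Y, #{q ∈ Y | #{z ∈ Y | ‖z - y‖ ≤ ‖q - y‖} * s ≤ 64 * #Y} := by
    simp only [closePairs, card_filter, sum_product]
  rw [h, sum_mul]
  have : ∀ y ∈ Y, #{q ∈ Y | #{z ∈ Y | ‖z - y‖ ≤ ‖q - y‖} * s ≤ 64 * #Y} * s ≤ 64 * #Y := by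
    intro y hy
    set N := ({q ∈ Y | #{z ∈ Y | ‖z - y‖ ≤ ‖q - y‖} * s ≤ 64 * #Y} : Finset ℂ) with hN
    rcases N.eq_empty_or_nonempty with h0 | h0
    · rw [h0]; simp
    · obtain ⟨q, hq, hmax⟩ := exists_max_image N (fun q => ‖q - y‖) h0
      have hq2 := (mem_filter.1 hq).2
      refine le_trans (Nat.mul_le_mul_right _ (card_le_card ?_)) hq2
      intro q' hq'
      exact mem_filter.2 ⟨(mem_filter.1 hq').1, hmax q' hq'⟩
  calc _ ≤ ∑ y ∈ Y, 64 * #Y := sum_le_sum this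
    _ = 64 * #Y ^ 2 := by rw [sum_const, smul_eq_mul]; ring

/-- Few members of `T` have many points of `Y` in their nearest-neighbour disc. -/
lemma card_crowded_mul_le (T Y : Finset ℂ) (hT : T.Nonempty) (ρ : ℂ → ℝ)
    (hρ : ∀ y ∈ T, ∀ y' ∈ T, y ≠ y' → ρ y ≤ ‖y' - y‖) :
    4 * #{y ∈ T | 64 * #Y < #{z ∈ Y | ‖z - y‖ ≤ ρ y} * #T} ≤ #T := by
  set N := ({y ∈ T | 64 * #Y < #{z ∈ Y | ‖z - y‖ ≤ ρ y} * #T} : Finset ℂ) with hN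
  have h1 : ∑ y ∈ T, #{z ∈ Y | ‖z - y‖ ≤ ρ y} ≤ 16 * #Y := by
    have := sum_card_bipartiteAbove_eq_sum_card_bipartiteBelow (s := T) (t := Y)
      (fun y z => ‖z - y‖ ≤ ρ y)
    simp only [bipartiteAbove, bipartiteBelow] at this
    rw [this]
    calc _ ≤ ∑ z ∈ Y, 16 := sum_le_sum fun z _ => card_discs_containing_le T ρ hρ z
      _ = 16 * #Y := by rw [sum_const, smul_eq_mul, mul_comm]
  have hTpos : 0 < #T := hT.card_pos
  rcases Nat.eq_zero_or_pos #Y with hY | hY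
  · have : N = ∅ := by
      rw [hN, filter_eq_empty_iff]
      intro y _
      rw [card_eq_zero.1 hY]
      simp
    rw [this]; simp
  have h2 : #N * (64 * #Y) ≤ 16 * #Y * #T := by
    calc #N * (64 * #Y) = ∑ y ∈ N, 64 * #Y := by rw [sum_const, smul_eq_mul]
      _ ≤ ∑ y ∈ N, #{z ∈ Y | ‖z - y‖ ≤ ρ y} * #T :=
        sum_le_sum fun y hy => (mem_filter.1 hy).2.le
      _ ≤ ∑ y ∈ T, #{z ∈ Y | ‖z - y‖ ≤ ρ y} * #T :=
        sum_le_sum_of_subset (filter_subset _ _)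
      _ ≤ 16 * #Y * #T := by rw [← sum_mul]; exact Nat.mul_le_mul_right _ h1
  have : (16 * #Y) * (4 * #N) ≤ (16 * #Y) * #T := by linarith
  exact Nat.le_of_mul_le_mul_left this (by omega)

lemma le_two_mul_card_closePairs (Y D : Finset ℂ) {x b : ℂ} (hx : x ≠ 0) {s : ℕ} (hs : 2 ≤ s)
    (h : s ≤ #{y ∈ Y | x * y - b ∈ D}) :
    s ≤ 2 * #{q ∈ closePairs Y s | q.1 ≠ q.2 ∧ (x * q.1 - b, x * q.2 - b) ∈ closePairs D s} := by
  set T := ({y ∈ Y | x * y - b ∈ D} : Finset ℂ) with hT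
  have hmem : ∀ y ∈ T, y ∈ Y ∧ x * y - b ∈ D := fun y hy => mem_filter.1 hy
  have hnn : ∀ y : ℂ, ∃ y', y ∈ T → y' ∈ T ∧ y' ≠ y ∧ ∀ z ∈ T, y ≠ z → ‖y' - y‖ ≤ ‖z - y‖ := by
    intro y
    by_cases hy : y ∈ T
    · have hne : (T.erase y).Nonempty := by
        rw [← card_pos, card_erase_of_mem hy]
        omega
      obtain ⟨y', hy', hmin⟩ := exists_min_image (T.erase y) (fun z => ‖z - y‖) hne
      exact ⟨y', fun _ => ⟨mem_of_mem_erase hy', ne_of_mem_erase hy',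
        fun z hz hyz => hmin z (mem_erase.2 ⟨hyz.symm, hz⟩)⟩⟩
    · exact ⟨0, fun h => absurd h hy⟩
  choose nn hnn using hnn
  have hTne : T.Nonempty := by
    rw [← card_pos]
    omega
  let D' := D.image fun w => (w + b) / x
  have hinj : Function.Injective fun w : ℂ => (w + b) / x := by
    intro w w' hw
    simpa [div_left_inj' hx] using hw
  have hD' : #D' = #D := card_image_of_injective _ hinj
  have c1 := card_crowded_mul_le T Y hTne (fun y => ‖nn y - y‖) (fun y hy => (hnn y hy).2.2)
  have c2 := card_crowded_mul_le T D' hTne (fun y => ‖nn y - y‖) (fun y hy => (hnn y hy).2.2)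
  rw [hD'] at c2
  set N1 := ({y ∈ T | 64 * #Y < #{z ∈ Y | ‖z - y‖ ≤ ‖nn y - y‖} * #T} : Finset ℂ)
  set N2 := ({y ∈ T | 64 * #D < #{z ∈ D' | ‖z - y‖ ≤ ‖nn y - y‖} * #T} : Finset ℂ)
  have hG : s ≤ 2 * #((T \ N1) \ N2) := by
    have e1 := le_card_sdiff N1 T
    have e2 := le_card_sdiff N2 (T \ N1)
    omega
  refine hG.trans (Nat.mul_le_mul_left _ (card_le_card_of_injOn (fun y => (y, nn y)) ?_ ?_))
  · intro y hy
    have hy := mem_sdiff.1 (mem_coe.1 hy)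
    have hyT := (mem_sdiff.1 hy.1).1
    have hy1 : #{z ∈ Y | ‖z - y‖ ≤ ‖nn y - y‖} * #T ≤ 64 * #Y := by
      by_contra hc
      exact (mem_sdiff.1 hy.1).2 (mem_filter.2 ⟨hyT, not_le.1 hc⟩)
    have hy2 : #{z ∈ D' | ‖z - y‖ ≤ ‖nn y - y‖} * #T ≤ 64 * #D := by
      by_contra hc
      exact hy.2 (mem_filter.2 ⟨hyT, not_le.1 hc⟩)
    obtain ⟨n1, n2, -⟩ := hnn y hyT
    simp only [coe_filter, closePairs, mem_filter, mem_product]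
    refine ⟨⟨⟨(hmem _ hyT).1, (hmem _ n1).1⟩, (Nat.mul_le_mul_left _ h).trans hy1⟩, n2.symm,
      ⟨(hmem _ hyT).2, (hmem _ n1).2⟩, le_trans (Nat.mul_le_mul ?_ h) hy2⟩
    refine card_le_card_of_injOn (fun w => (w + b) / x) ?_ hinj.injOn
    intro w hw
    obtain ⟨hw1, hw2⟩ := mem_filter.1 (mem_coe.1 hw)
    refine mem_coe.2 (mem_filter.2 ⟨mem_image_of_mem _ hw1, ?_⟩)
    have e1 : w - (x * y - b) = x * ((w + b) / x - y) := by field_simp; ring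
    have e2 : x * nn y - b - (x * y - b) = x * (nn y - y) := by ring
    rw [e1, e2, norm_mul, norm_mul] at hw2
    exact le_of_mul_le_mul_left hw2 (norm_pos_iff.2 hx)
  · intro y _ y' _ hyy
    exact (Prod.mk.inj hyy).1

/-- The Szemerédi–Trotter bound for rich lines over `ℂ`, for a Cartesian product of points. -/
lemma card_rich_lines_mul_le (Y D : Finset ℂ) (Λ : Finset (ℂ × ℂ)) (hΛ : ∀ l ∈ Λ, l.1 ≠ 0)
    {s : ℕ} (hs : 2 ≤ s) (h : ∀ l ∈ Λ, s ≤ #{y ∈ Y | l.1 * y - l.2 ∈ D}) :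
    #Λ * s ^ 3 ≤ 8192 * #Y ^ 2 * #D ^ 2 := by
  set R : ℂ × ℂ → ℂ × ℂ → Prop := fun l q =>
    q.1 ≠ q.2 ∧ (l.1 * q.1 - l.2, l.1 * q.2 - l.2) ∈ closePairs D s with hR
  have h1 : #Λ * s ≤ 2 * (#(closePairs Y s) * #(closePairs D s)) := by
    classical
    calc #Λ * s = ∑ l ∈ Λ, s := by rw [sum_const, smul_eq_mul]
      _ ≤ ∑ l ∈ Λ, 2 * #{q ∈ closePairs Y s | R l q} := by
        refine sum_le_sum fun l hl => ?_
        convert le_two_mul_card_closePairs Y D (hΛ l hl) hs (h l hl)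
      _ = 2 * ∑ q ∈ closePairs Y s, #{l ∈ Λ | R l q} := by
        rw [← mul_sum]
        congr 1
        exact sum_card_bipartiteAbove_eq_sum_card_bipartiteBelow R
      _ ≤ 2 * ∑ q ∈ closePairs Y s, #(closePairs D s) := by
        refine Nat.mul_le_mul_left _ (sum_le_sum fun q _ => ?_)
        refine card_le_card_of_injOn (fun l => (l.1 * q.1 - l.2, l.1 * q.2 - l.2)) ?_ ?_
        · intro l hl
          exact (mem_filter.1 (mem_coe.1 hl)).2.2
        · intro l hl l' _ hll
          have hq : q.1 - q.2 ≠ 0 := sub_ne_zero.2 (mem_filter.1 (mem_coe.1 hl)).2.1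
          obtain ⟨e1, e2⟩ := Prod.mk.inj hll
          have e3 : l.1 = l'.1 := mul_right_cancel₀ hq (by linear_combination e1 - e2)
          refine Prod.ext e3 ?_
          rw [e3] at e1
          exact sub_right_injective e1
      _ = _ := by rw [sum_const, smul_eq_mul]
  have h2 := card_closePairs_mul_le Y s
  have h3 := card_closePairs_mul_le D s
  calc #Λ * s ^ 3 = (#Λ * s) * s ^ 2 := by ring
    _ ≤ 2 * (#(closePairs Y s) * #(closePairs D s)) * s ^ 2 := by gcongr
    _ = 2 * ((#(closePairs Y s) * s) * (#(closePairs D s) * s)) := by ring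
    _ ≤ 2 * ((64 * #Y ^ 2) * (64 * #D ^ 2)) := by gcongr
    _ = _ := by ring

lemma exists_dyadic_level {ι : Type*} (A : Finset ι) (f w : ι → ℕ) {N : ℕ}
    (hf : ∀ i ∈ A, f i ≤ N) (hw : ∀ i ∈ A, f i = 0 → w i = 0) :
    ∃ j : ℕ, ∑ i ∈ A, w i ≤
      (Nat.log 2 N + 1) * ∑ i ∈ A with 2 ^ j ≤ f i ∧ f i < 2 ^ (j + 1), w i := by
  set A' := ({i ∈ A | f i ≠ 0} : Finset ι) with hA'
  have hsum : ∑ i ∈ A, w i = ∑ i ∈ A', w i := by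
    rw [hA', sum_filter_of_ne]
    intro i hi hwi hfi
    exact hwi (hw i hi hfi)
  have hmaps : ∀ i ∈ A', Nat.log 2 (f i) ∈ range (Nat.log 2 N + 1) := by
    intro i hi
    exact mem_range.2 (Nat.lt_succ_of_le (Nat.log_mono_right (hf i (mem_filter.1 hi).1)))
  obtain ⟨j, -, hj⟩ := exists_le_of_sum_le (s := range (Nat.log 2 N + 1))
    (f := fun _ => ∑ i ∈ A', w i)
    (g := fun j => (Nat.log 2 N + 1) * ∑ i ∈ A' with Nat.log 2 (f i) = j, w i)
    ⟨0, by simp⟩ (by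
      rw [← mul_sum, sum_fiberwise_of_maps_to hmaps, sum_const, card_range, smul_eq_mul])
  refine ⟨j, hsum ▸ hj.trans (Nat.mul_le_mul_left _ (sum_le_sum_of_subset ?_))⟩
  intro i hi
  obtain ⟨hi1, rfl⟩ := mem_filter.1 hi
  obtain ⟨hi2, hi3⟩ := mem_filter.1 hi1
  exact mem_filter.2 ⟨hi2, Nat.pow_log_le_self 2 hi3, Nat.lt_pow_succ_log_self one_lt_two _⟩

/-- The Szemerédi–Trotter incidence bound over `ℂ`, for a Cartesian product of points, up to
logarithms. -/
lemma incidences_le (Y D : Finset ℂ) (Λ : Finset (ℂ × ℂ)) (hΛ : ∀ l ∈ Λ, l.1 ≠ 0) {m : ℕ}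
    (hY : #Y ≤ m) :
    ∑ l ∈ Λ, #{y ∈ Y | l.1 * y - l.2 ∈ D} ≤ (Nat.log 2 m + 1) * #Λ ∨
    (∑ l ∈ Λ, #{y ∈ Y | l.1 * y - l.2 ∈ D}) ^ 3 ≤
      65536 * (Nat.log 2 m + 1) ^ 3 * #Λ ^ 2 * #Y ^ 2 * #D ^ 2 := by
  set n : ℂ × ℂ → ℕ := fun l => #{y ∈ Y | l.1 * y - l.2 ∈ D} with hn
  set L := Nat.log 2 m + 1
  obtain ⟨j, hj⟩ := exists_dyadic_level Λ n n (N := m)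
    (fun l _ => (card_filter_le _ _).trans hY) (fun _ _ h => h)
  set Λ' := ({l ∈ Λ | 2 ^ j ≤ n l ∧ n l < 2 ^ (j + 1)} : Finset (ℂ × ℂ)) with hΛ'
  have hle : #Λ' ≤ #Λ := card_filter_le _ _
  rcases Nat.eq_zero_or_pos j with h0 | h0
  · left
    refine hj.trans (Nat.mul_le_mul_left _ ?_)
    calc ∑ l ∈ Λ', n l ≤ ∑ l ∈ Λ', 1 := by
          refine sum_le_sum fun l hl => ?_
          have := (mem_filter.1 hl).2.2
          rw [h0] at this
          omega
      _ ≤ #Λ := by rw [sum_const, smul_eq_mul, mul_one]; exact hle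
  · right
    have h1 : ∑ l ∈ Λ', n l ≤ #Λ' * (2 * 2 ^ j) := by
      rw [← smul_eq_mul, ← sum_const]
      refine sum_le_sum fun l hl => ?_
      have := (mem_filter.1 hl).2.2
      rw [pow_succ] at this
      omega
    have h2 := card_rich_lines_mul_le Y D Λ' (fun l hl => hΛ l (mem_filter.1 hl).1) (s := 2 ^ j)
      (by calc 2 = 2 ^ 1 := rfl
            _ ≤ 2 ^ j := Nat.pow_le_pow_right (by norm_num) h0)
      (fun l hl => (mem_filter.1 hl).2.1)
    calc (∑ l ∈ Λ, n l) ^ 3 ≤ (L * (#Λ' * (2 * 2 ^ j))) ^ 3 := by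
          gcongr
          exact hj.trans (Nat.mul_le_mul_left _ h1)
      _ = 8 * L ^ 3 * #Λ' ^ 2 * (#Λ' * (2 ^ j) ^ 3) := by ring
      _ ≤ 8 * L ^ 3 * #Λ ^ 2 * (8192 * #Y ^ 2 * #D ^ 2) := by gcongr
      _ = _ := by ring

/-- The number of solutions of `f a₁ + f b₁ = f a₂ + f b₂` in `A`. -/
noncomputable def energy (f : ℂ → ℂ) (A : Finset ℂ) : ℕ :=
  #{q ∈ (A ×ˢ A) ×ˢ (A ×ˢ A) | f q.1.1 + f q.2.1 = f q.1.2 + f q.2.2}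

lemma energy_mono (f : ℂ → ℂ) {A B : Finset ℂ} (h : A ⊆ B) : energy f A ≤ energy f B :=
  card_le_card (filter_subset_filter _
    (product_subset_product (product_subset_product h h) (product_subset_product h h)))

lemma energy_pos (f : ℂ → ℂ) {A : Finset ℂ} (h : A.Nonempty) : 0 < energy f A := by
  obtain ⟨a, ha⟩ := h
  exact card_pos.2 ⟨((a, a), (a, a)), by simp [ha]⟩

lemma card_eq_keys_le_sum_sq (S : Finset (ℂ × ℂ)) (k k' : ℂ × ℂ → ℂ) (X : Finset ℂ) (r : ℂ → ℕ)
    (hX : ∀ p ∈ S, k p ∈ X) (hk : ∀ x, #{p ∈ S | k p = x} ≤ r x)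
    (hk' : ∀ x, #{p ∈ S | k' p = x} ≤ r x) :
    #{q ∈ S ×ˢ S | k q.1 = k' q.2} ≤ ∑ x ∈ X, r x ^ 2 := by
  rw [card_eq_sum_card_fiberwise (f := fun q : (ℂ × ℂ) × (ℂ × ℂ) => k q.1) (t := X)]
  · refine sum_le_sum fun x _ => ?_
    calc _ ≤ #({p ∈ S | k p = x} ×ˢ {p ∈ S | k' p = x}) := by
          refine card_le_card fun q hq => ?_
          simp only [mem_filter, mem_product] at hq ⊢
          exact ⟨⟨hq.1.1.1, hq.2⟩, ⟨hq.1.1.2, hq.1.2 ▸ hq.2⟩⟩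
      _ ≤ r x ^ 2 := by
          rw [card_product, sq]
          exact Nat.mul_le_mul (hk x) (hk' x)
  · intro q hq
    exact hX _ (mem_product.1 (mem_filter.1 (mem_coe.1 hq)).1).1

lemma energy_id_le_sum_sq (A : Finset ℂ) :
    energy id A ≤ ∑ d ∈ (A ×ˢ A).image (fun p => p.1 - p.2), #{b ∈ A | d + b ∈ A} ^ 2 := by
  have h := card_eq_keys_le_sum_sq (A ×ˢ A) (fun p => p.1 - p.2) (fun p => p.2 - p.1)
    ((A ×ˢ A).image (fun p => p.1 - p.2)) (fun d => #{b ∈ A | d + b ∈ A})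
    (fun p hp => mem_image_of_mem (fun p : ℂ × ℂ => p.1 - p.2) hp) (fun x => ?_) (fun x => ?_)
  · refine le_trans (card_le_card fun q hq => ?_) h
    simp only [mem_filter, id] at hq ⊢
    exact ⟨hq.1, by linear_combination hq.2⟩
  · refine card_le_card_of_injOn Prod.snd (fun p hp => ?_) (fun p hp p' hp' h => ?_)
    · obtain ⟨hm, rfl⟩ := mem_filter.1 (mem_coe.1 hp)
      simpa using (mem_product.1 hm).symm
    · obtain ⟨-, h1⟩ := mem_filter.1 (mem_coe.1 hp)
      obtain ⟨-, h2⟩ := mem_filter.1 (mem_coe.1 hp')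
      exact Prod.ext (by linear_combination h1 - h2 + h) h
  · refine card_le_card_of_injOn Prod.fst (fun p hp => ?_) (fun p hp p' hp' h => ?_)
    · obtain ⟨hm, rfl⟩ := mem_filter.1 (mem_coe.1 hp)
      simpa using mem_product.1 hm
    · obtain ⟨-, h1⟩ := mem_filter.1 (mem_coe.1 hp)
      obtain ⟨-, h2⟩ := mem_filter.1 (mem_coe.1 hp')
      exact Prod.ext h (by linear_combination h1 - h2 + h)

lemma energy_le_sum_sq_ratio (f : ℂ → ℂ) (A : Finset ℂ) (h0 : ∀ a ∈ A, a ≠ 0)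
    (hf : ∀ a ∈ A, ∀ b ∈ A, ∀ c ∈ A, ∀ d ∈ A, f a + f b = f c + f d → a * b = c * d) :
    energy f A ≤ ∑ x ∈ (A ×ˢ A).image (fun p => p.1 / p.2), #{b ∈ A | x * b ∈ A} ^ 2 := by
  have h := card_eq_keys_le_sum_sq (A ×ˢ A) (fun p => p.1 / p.2) (fun p => p.2 / p.1)
    ((A ×ˢ A).image (fun p => p.1 / p.2)) (fun d => #{b ∈ A | d * b ∈ A})
    (fun p hp => mem_image_of_mem (fun p : ℂ × ℂ => p.1 / p.2) hp) (fun x => ?_) (fun x => ?_)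
  · refine le_trans (card_le_card fun q hq => ?_) h
    simp only [mem_filter, mem_product] at hq ⊢
    obtain ⟨⟨⟨h1, h2⟩, h3, h4⟩, h5⟩ := hq
    refine ⟨⟨⟨h1, h2⟩, h3, h4⟩, ?_⟩
    rw [div_eq_div_iff (h0 _ h2) (h0 _ h3), hf _ h1 _ h3 _ h2 _ h4 h5, mul_comm]
  · refine card_le_card_of_injOn Prod.snd (fun p hp => ?_) (fun p hp p' hp' h => ?_)
    · obtain ⟨hm, rfl⟩ := mem_filter.1 (mem_coe.1 hp)
      have := mem_product.1 hm
      exact mem_coe.2 (mem_filter.2 ⟨this.2, by rw [div_mul_cancel₀ _ (h0 _ this.2)]; exact this.1⟩)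
    · obtain ⟨m1, h1⟩ := mem_filter.1 (mem_coe.1 hp)
      obtain ⟨m2, h2⟩ := mem_filter.1 (mem_coe.1 hp')
      rw [div_eq_iff (h0 _ (mem_product.1 m1).2)] at h1
      rw [div_eq_iff (h0 _ (mem_product.1 m2).2)] at h2
      exact Prod.ext (by rw [h1, h2, h]) h
  · refine card_le_card_of_injOn Prod.fst (fun p hp => ?_) (fun p hp p' hp' h => ?_)
    · obtain ⟨hm, rfl⟩ := mem_filter.1 (mem_coe.1 hp)
      have := mem_product.1 hm
      exact mem_coe.2 (mem_filter.2 ⟨this.1, by rw [div_mul_cancel₀ _ (h0 _ this.1)]; exact this.2⟩)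
    · obtain ⟨m1, h1⟩ := mem_filter.1 (mem_coe.1 hp)
      obtain ⟨m2, h2⟩ := mem_filter.1 (mem_coe.1 hp')
      rw [div_eq_iff (h0 _ (mem_product.1 m1).1)] at h1
      rw [div_eq_iff (h0 _ (mem_product.1 m2).1)] at h2
      exact Prod.ext h (by rw [h1, h2, h])

lemma energy_arith {E M P τ t c m D s L : ℕ} (h1 : M ≤ L * (P * (4 * τ ^ 2)))
    (h2 : P * τ ≤ L * (c * (2 * t))) (h3 : t ≤ m) (ht : 0 < t) (hL : 0 < L)
    (h4 : E ≤ L * (D * (4 * s ^ 2))) (h5 : D * s ≤ c ^ 2) (h6 : s ≤ c)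
    (h7 : D * s * t ≤ L * (P * c) ∨ (D * s * t) ^ 3 ≤ 65536 * L ^ 3 * (P * c) ^ 2 * m ^ 2 * D ^ 2) :
    E ^ 2 * M ^ 2 ≤ 2 ^ 28 * L ^ 11 * m ^ 3 * c ^ 8 := by
  have hm : 0 < m := ht.trans_le h3
  rcases h7 with h7 | h7
  · have e : (E * M) * t ≤ (64 * L ^ 5 * m * c ^ 4) * t := by
      calc (E * M) * t ≤ (L * (D * (4 * s ^ 2))) * (L * (P * (4 * τ ^ 2))) * t := by gcongr
        _ = 16 * L ^ 2 * (D * s * t) * s * P * τ ^ 2 := by ring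
        _ ≤ 16 * L ^ 2 * (L * (P * c)) * c * P * τ ^ 2 := by gcongr
        _ = 16 * L ^ 3 * c ^ 2 * (P * τ) ^ 2 := by ring
        _ ≤ 16 * L ^ 3 * c ^ 2 * (L * (c * (2 * t))) ^ 2 := by gcongr
        _ = 64 * L ^ 5 * c ^ 4 * t * t := by ring
        _ ≤ 64 * L ^ 5 * c ^ 4 * m * t := by gcongr
        _ = _ := by ring
    have e' := Nat.le_of_mul_le_mul_right e ht
    calc E ^ 2 * M ^ 2 = (E * M) ^ 2 := by ring
      _ ≤ (64 * L ^ 5 * m * c ^ 4) ^ 2 := by gcongr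
      _ = 4096 * L ^ 10 * m ^ 2 * c ^ 8 := by ring
      _ ≤ 2 ^ 28 * L ^ 11 * m ^ 3 * c ^ 8 := by
        have hL' : L ^ 10 ≤ L ^ 11 := Nat.pow_le_pow_right hL (by norm_num)
        have hm' : m ^ 2 ≤ m ^ 3 := Nat.pow_le_pow_right hm (by norm_num)
        have hk : 4096 ≤ 2 ^ 28 := by norm_num
        gcongr
  · rcases Nat.eq_zero_or_pos D with hD | hD
    · have : E = 0 := by rw [hD] at h4; simpa using h4
      rw [this]; simp
    have h8 : D * s ^ 3 * t ^ 3 ≤ 65536 * L ^ 3 * (P * c) ^ 2 * m ^ 2 := by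
      refine le_of_mul_le_mul_right ?_ (pow_pos hD 2)
      calc D * s ^ 3 * t ^ 3 * D ^ 2 = (D * s * t) ^ 3 := by ring
        _ ≤ _ := h7
    refine le_of_mul_le_mul_right ?_ (pow_pos ht 3)
    calc E ^ 2 * M ^ 2 * t ^ 3
        ≤ (L * (D * (4 * s ^ 2))) ^ 2 * (L * (P * (4 * τ ^ 2))) ^ 2 * t ^ 3 := by gcongr
      _ = 256 * L ^ 4 * (D * s) * (D * s ^ 3 * t ^ 3) * P ^ 2 * τ ^ 4 := by ring
      _ ≤ 256 * L ^ 4 * (c ^ 2) * (65536 * L ^ 3 * (P * c) ^ 2 * m ^ 2) * P ^ 2 * τ ^ 4 := by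
        gcongr
      _ = 2 ^ 24 * L ^ 7 * c ^ 4 * m ^ 2 * (P * τ) ^ 4 := by ring
      _ ≤ 2 ^ 24 * L ^ 7 * c ^ 4 * m ^ 2 * (L * (c * (2 * t))) ^ 4 := by gcongr
      _ = 2 ^ 28 * L ^ 11 * c ^ 8 * m ^ 2 * t * t ^ 3 := by ring
      _ ≤ 2 ^ 28 * L ^ 11 * c ^ 8 * m ^ 2 * m * t ^ 3 := by gcongr
      _ = _ := by ring

/-- A set contains a subset whose additive energy is small if the multiplicative energy of the
whole set is large. -/
lemma exists_subset_energy_mul_le (f : ℂ → ℂ) (C : Finset ℂ) (hne : C.Nonempty)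
    (h0 : ∀ a ∈ C, a ≠ 0)
    (hf : ∀ a ∈ C, ∀ b ∈ C, ∀ c ∈ C, ∀ d ∈ C, f a + f b = f c + f d → a * b = c * d) :
    ∃ C' ⊆ C, C'.Nonempty ∧ energy id C' ^ 2 * energy f C ^ 2 ≤
      2 ^ 28 * (Nat.log 2 #C + 1) ^ 11 * #C ^ 3 * #C' ^ 8 := by
  set L := Nat.log 2 #C + 1 with hL
  set X := (C ×ˢ C).image (fun p => p.1 / p.2) with hX
  have hX0 : ∀ x ∈ X, x ≠ 0 := by
    intro x hx
    obtain ⟨p, hp, rfl⟩ := mem_image.1 hx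
    exact div_ne_zero (h0 _ (mem_product.1 hp).1) (h0 _ (mem_product.1 hp).2)
  set r : ℂ → ℕ := fun x => #{b ∈ C | x * b ∈ C} with hr
  obtain ⟨i, hi⟩ := exists_dyadic_level X r (fun x => r x ^ 2) (N := #C)
    (fun x _ => card_filter_le _ _) (fun x _ h => by simp [h])
  set P := ({x ∈ X | 2 ^ i ≤ r x ∧ r x < 2 ^ (i + 1)} : Finset ℂ) with hP
  set τ := 2 ^ i with hτ
  have h1 : energy f C ≤ L * (#P * (4 * τ ^ 2)) := by
    refine (energy_le_sum_sq_ratio f C h0 hf).trans (hi.trans (Nat.mul_le_mul_left _ ?_))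
    rw [← smul_eq_mul, ← sum_const]
    refine sum_le_sum fun x hx => ?_
    have := (mem_filter.1 hx).2.2.le
    calc r x ^ 2 ≤ (2 ^ (i + 1)) ^ 2 := Nat.pow_le_pow_left this 2
      _ = 4 * τ ^ 2 := by rw [hτ]; ring
  set t : ℂ → ℕ := fun c => #{x ∈ P | c / x ∈ C} with ht
  have htC : ∀ c ∈ C, t c ≤ #C := by
    intro c hc
    refine card_le_card_of_injOn (fun x => c / x) (fun x hx => (mem_filter.1 (mem_coe.1 hx)).2) ?_
    intro x hx y hy hxy
    have hx0 := hX0 x (mem_filter.1 (mem_filter.1 (mem_coe.1 hx)).1).1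
    have hy0 := hX0 y (mem_filter.1 (mem_filter.1 (mem_coe.1 hy)).1).1
    simp only at hxy
    rw [div_eq_div_iff hx0 hy0] at hxy
    exact (mul_left_cancel₀ (h0 c hc) hxy).symm
  have hPτ : #P * τ ≤ ∑ c ∈ C, t c := by
    have := sum_card_bipartiteAbove_eq_sum_card_bipartiteBelow (s := C) (t := P)
      (fun c x => c / x ∈ C)
    simp only [bipartiteAbove, bipartiteBelow] at this
    rw [this, ← smul_eq_mul, ← sum_const]
    refine sum_le_sum fun x hx => ?_
    have hx0 := hX0 x (mem_filter.1 hx).1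
    refine (mem_filter.1 hx).2.1.trans ?_
    refine card_le_card_of_injOn (fun b => x * b) ?_ (mul_right_injective₀ hx0).injOn
    intro b hb
    obtain ⟨hb1, hb2⟩ := mem_filter.1 (mem_coe.1 hb)
    refine mem_coe.2 (mem_filter.2 ⟨hb2, ?_⟩)
    rwa [mul_div_cancel_left₀ _ hx0]
  obtain ⟨k, hk⟩ := exists_dyadic_level C t t (N := #C) htC (fun _ _ h => h)
  set C' := ({c ∈ C | 2 ^ k ≤ t c ∧ t c < 2 ^ (k + 1)} : Finset ℂ) with hC'
  have hC'C : C' ⊆ C := filter_subset _ _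
  set T := 2 ^ k with hT
  have h2 : #P * τ ≤ L * (#C' * (2 * T)) := by
    refine hPτ.trans (hk.trans (Nat.mul_le_mul_left _ ?_))
    rw [← smul_eq_mul, ← sum_const]
    refine sum_le_sum fun c hc => ?_
    have := (mem_filter.1 hc).2.2.le
    rw [pow_succ] at this
    omega
  have hC'ne : C'.Nonempty := by
    rw [nonempty_iff_ne_empty]
    intro he
    have hM := energy_pos f hne
    rw [he, card_empty, zero_mul, mul_zero, Nat.le_zero, mul_eq_zero] at h2
    rcases h2 with h | h <;> rw [h] at h1 <;> simp at h1 <;> omega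
  refine ⟨C', hC'C, hC'ne, ?_⟩
  obtain ⟨c₀, hc₀⟩ := hC'ne
  set Z := (C' ×ˢ C').image (fun p => p.1 - p.2) with hZ
  set u : ℂ → ℕ := fun d => #{b ∈ C' | d + b ∈ C'} with hu
  obtain ⟨j, hj⟩ := exists_dyadic_level Z u (fun d => u d ^ 2) (N := #C)
    (fun x _ => (card_filter_le _ _).trans (card_le_card hC'C)) (fun x _ h => by simp [h])
  set D := ({x ∈ Z | 2 ^ j ≤ u x ∧ u x < 2 ^ (j + 1)} : Finset ℂ) with hD
  set s := 2 ^ j with hs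
  have h4 : energy id C' ≤ L * (#D * (4 * s ^ 2)) := by
    refine (energy_id_le_sum_sq C').trans (hj.trans (Nat.mul_le_mul_left _ ?_))
    rw [← smul_eq_mul, ← sum_const]
    refine sum_le_sum fun x hx => ?_
    have := (mem_filter.1 hx).2.2.le
    calc u x ^ 2 ≤ (2 ^ (j + 1)) ^ 2 := Nat.pow_le_pow_left this 2
      _ = 4 * s ^ 2 := by rw [hs]; ring
  rcases D.eq_empty_or_nonempty with hDe | hDne
  · rw [hDe] at h4
    have : energy id C' = 0 := by simpa using h4
    rw [this]; simp
  obtain ⟨d₀, hd₀⟩ := hDne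
  have h6 : s ≤ #C' := (mem_filter.1 hd₀).2.1.trans (card_filter_le _ _)
  have h5 : #D * s ≤ #C' ^ 2 := by
    calc #D * s = ∑ d ∈ D, s := by rw [sum_const, smul_eq_mul]
      _ ≤ ∑ d ∈ D, u d := sum_le_sum fun d hd => (mem_filter.1 hd).2.1
      _ = ∑ b ∈ C', #{d ∈ D | d + b ∈ C'} :=
        sum_card_bipartiteAbove_eq_sum_card_bipartiteBelow (fun d b => d + b ∈ C')
      _ ≤ ∑ b ∈ C', #C' := by
        refine sum_le_sum fun b _ => ?_
        exact card_le_card_of_injOn (fun d => d + b)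
          (fun d hd => (mem_filter.1 (mem_coe.1 hd)).2) (add_left_injective b).injOn
      _ = #C' ^ 2 := by rw [sum_const, smul_eq_mul, sq]
  have hPC : #(P ×ˢ C') = #P * #C' := card_product _ _
  have hinc : #D * s * T ≤ ∑ l ∈ P ×ˢ C', #{y ∈ C | l.1 * y - l.2 ∈ D} := by
    calc #D * s * T = ∑ d ∈ D, s * T := by rw [sum_const, smul_eq_mul, mul_assoc]
      _ ≤ ∑ d ∈ D, ∑ b ∈ C' with d + b ∈ C', t (d + b) := by
        refine sum_le_sum fun d hd => ?_
        calc s * T ≤ u d * T := Nat.mul_le_mul_right _ (mem_filter.1 hd).2.1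
          _ = ∑ b ∈ C' with d + b ∈ C', T := by rw [sum_const, smul_eq_mul]
          _ ≤ _ := sum_le_sum fun b hb => (mem_filter.1 (mem_filter.1 hb).2).2.1
      _ ≤ ∑ d ∈ D, ∑ b ∈ C', #{x ∈ P | (d + b) / x ∈ C} :=
        sum_le_sum fun d _ => sum_le_sum_of_subset (filter_subset _ _)
      _ = ∑ d ∈ D, #{l ∈ P ×ˢ C' | (d + l.2) / l.1 ∈ C} := by
        refine sum_congr rfl fun d _ => ?_
        simp only [card_filter, sum_product_right]
      _ = ∑ l ∈ P ×ˢ C', #{d ∈ D | (d + l.2) / l.1 ∈ C} :=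
        sum_card_bipartiteAbove_eq_sum_card_bipartiteBelow
          (fun d (l : ℂ × ℂ) => (d + l.2) / l.1 ∈ C)
      _ ≤ _ := by
        refine sum_le_sum fun l hl => ?_
        have hx0 := hX0 l.1 (mem_filter.1 (mem_product.1 hl).1).1
        refine card_le_card_of_injOn (fun d => (d + l.2) / l.1) (fun d hd => ?_) ?_
        · obtain ⟨hd1, hd2⟩ := mem_filter.1 (mem_coe.1 hd)
          refine mem_coe.2 (mem_filter.2 ⟨hd2, ?_⟩)
          rwa [mul_div_cancel₀ _ hx0, add_sub_cancel_right]
        · intro d _ d' _ hdd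
          simpa [div_left_inj' hx0] using hdd
  have h7 := incidences_le C D (P ×ˢ C') (fun l hl => hX0 l.1 (mem_filter.1 (mem_product.1 hl).1).1)
    le_rfl
  rw [hPC] at h7
  exact energy_arith h1 h2 ((mem_filter.1 hc₀).2.1.trans (htC c₀ (hC'C hc₀))) (by positivity)
    (Nat.succ_pos _) h4 h5 h6
    (h7.imp (fun h => hinc.trans h) (fun h => (Nat.pow_le_pow_left hinc 3).trans h))

lemma exists_int_freiman (A : Finset ℂ) : ∃ ψ : ℂ → ℤ, Set.InjOn ψ A ∧
    ∀ a ∈ A, ∀ b ∈ A, ∀ c ∈ A, ∀ d ∈ A, a + b = c + d → ψ a + ψ b = ψ c + ψ d := by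
  obtain ⟨φ, hφ⟩ := Module.exists_dual_forall_apply_ne_zero (K := ℚ)
    (fun q : {q : A × A // q.1 ≠ q.2} => (q.1.1 : ℂ) - (q.1.2 : ℂ))
    (fun q => sub_ne_zero.2 fun h => q.2 (Subtype.ext h))
  set N : ℕ := ∏ a ∈ A, (φ a).den with hN
  have hN0 : (N : ℚ) ≠ 0 := Nat.cast_ne_zero.2 (prod_ne_zero_iff.2 fun a _ => (φ a).den_nz)
  have hnum : ∀ a ∈ A, ((((N : ℚ) * φ a).num : ℤ) : ℚ) = N * φ a := by
    intro a ha
    obtain ⟨k, hk⟩ := dvd_prod_of_mem (fun a => (φ a).den) ha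
    have : (N : ℚ) * φ a = ((k * (φ a).num : ℤ) : ℚ) := by
      rw [hN, hk]
      push_cast
      nth_rewrite 2 [← Rat.num_div_den (φ a)]
      field_simp
    rw [this, Rat.num_intCast]
  refine ⟨fun a => ((N : ℚ) * φ a).num, ?_, ?_⟩
  · intro a ha b hb hab
    by_contra hne
    have h : ((((N : ℚ) * φ a).num : ℤ) : ℚ) = (((N : ℚ) * φ b).num : ℤ) :=
      congrArg (Int.cast : ℤ → ℚ) hab
    rw [hnum a ha, hnum b hb] at h
    refine hφ ⟨(⟨a, ha⟩, ⟨b, hb⟩), fun h => hne (congrArg Subtype.val h)⟩ ?_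
    rw [map_sub, mul_left_cancel₀ hN0 h, sub_self]
  · intro a ha b hb c hc d hd h
    have e : ((((N : ℚ) * φ a).num + ((N : ℚ) * φ b).num : ℤ) : ℚ) =
        (((N : ℚ) * φ c).num + ((N : ℚ) * φ d).num : ℤ) := by
      push_cast
      rw [hnum a ha, hnum b hb, hnum c hc, hnum d hd, ← mul_add, ← mul_add, ← map_add, ← map_add, h]
    exact_mod_cast e

/-- The index of the arc of length `q / p` of `ZMod q` containing `z`. -/
def arc (p : ℕ) {q : ℕ} (z : ZMod q) : ℕ := z.val * p / q

/-- Whether `z` lies in the upper half of its arc. -/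
def inUpperHalf (p : ℕ) {q : ℕ} (z : ZMod q) : Bool := decide (q ≤ 2 * (z.val * p % q))

lemma arc_lt {p q : ℕ} [NeZero q] (hp : 0 < p) (z : ZMod q) : arc p z < p := by
  refine (Nat.div_lt_iff_lt_mul (NeZero.pos q)).2 ?_
  rw [mul_comm p]
  exact Nat.mul_lt_mul_of_pos_right z.val_lt hp

lemma arc_add_eq {p q : ℕ} [NeZero q] {z₁ z₂ z₃ z₄ : ZMod q} (h : z₁ + z₂ = z₃ + z₄) {u : Bool}
    (h₁ : inUpperHalf p z₁ = u) (h₂ : inUpperHalf p z₂ = u) (h₃ : inUpperHalf p z₃ = u)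
    (h₄ : inUpperHalf p z₄ = u) :
    (arc p z₁ + arc p z₂ : ZMod p) = arc p z₃ + arc p z₄ := by
  have hq : 0 < q := NeZero.pos q
  have hv : ((z₁.val + z₂.val : ℤ) : ZMod q) = (z₃.val + z₄.val : ℤ) := by
    push_cast
    simpa using h
  obtain ⟨k, hk⟩ := (ZMod.intCast_eq_intCast_iff_dvd_sub _ _ _).1 hv
  have e : ∀ z : ZMod q, (z.val * p : ℤ) = q * arc p z + (z.val * p % q : ℕ) := by
    intro z
    exact_mod_cast (Nat.div_add_mod (z.val * p) q).symm
  have e1 := e z₁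
  have e2 := e z₂
  have e3 := e z₃
  have e4 := e z₄
  have l1 := Nat.mod_lt (z₁.val * p) hq
  have l2 := Nat.mod_lt (z₂.val * p) hq
  have l3 := Nat.mod_lt (z₃.val * p) hq
  have l4 := Nat.mod_lt (z₄.val * p) hq
  set r₁ := z₁.val * p % q with hr₁
  set r₂ := z₂.val * p % q with hr₂
  set r₃ := z₃.val * p % q with hr₃
  set r₄ := z₄.val * p % q with hr₄
  have hb : |(r₃ + r₄ - r₁ - r₂ : ℤ)| < q := by
    rw [abs_lt]
    simp only [inUpperHalf, ← hr₁, ← hr₂, ← hr₃, ← hr₄] at h₁ h₂ h₃ h₄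
    cases u
    · simp only [decide_eq_false_iff_not, not_le] at h₁ h₂ h₃ h₄
      constructor <;> omega
    · simp only [decide_eq_true_eq] at h₁ h₂ h₃ h₄
      constructor <;> omega
  have hr : (r₃ + r₄ - r₁ - r₂ : ℤ) =
      q * (p * k - (arc p z₃ + arc p z₄ - arc p z₁ - arc p z₂)) := by
    linear_combination (p : ℤ) * hk - e3 - e4 + e1 + e2
  have hr0 := Int.eq_zero_of_abs_lt_dvd ⟨_, hr⟩ hb
  rw [hr0] at hr
  have hc : (p : ℤ) * k - (arc p z₃ + arc p z₄ - arc p z₁ - arc p z₂) = 0 := by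
    rcases mul_eq_zero.1 hr.symm with h0 | h0
    · exact absurd h0 (by exact_mod_cast hq.ne')
    · exact h0
  have : ((arc p z₁ + arc p z₂ : ℤ) : ZMod p) = (arc p z₃ + arc p z₄ : ℤ) :=
    (ZMod.intCast_eq_intCast_iff_dvd_sub _ _ _).2 ⟨k, by linarith⟩
  simpa using this

lemma card_arc_eq_mul_le {p q : ℕ} [Fact q.Prime] (hp : 0 < p) (hpq : p ≤ q) {z z' : ZMod q}
    (hz : z ≠ z') : #{ξ : ZMod q | arc p (ξ * z) = arc p (ξ * z')} * p ≤ 3 * q := by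
  have hq : 0 < q := (Fact.out : q.Prime).pos
  have h : #{ξ : ZMod q | arc p (ξ * z) = arc p (ξ * z')} ≤
      #(Icc (-((q / p : ℕ) : ℤ)) ((q / p : ℕ) : ℤ)) := by
    refine card_le_card_of_injOn (fun ξ => ((ξ * z).val : ℤ) - ((ξ * z').val : ℤ)) ?_ ?_
    · intro ξ hξ
      have hξ := (mem_filter.1 (mem_coe.1 hξ)).2
      have e1 := Nat.div_add_mod ((ξ * z).val * p) q
      have e2 := Nat.div_add_mod ((ξ * z').val * p) q
      have l1 := Nat.mod_lt ((ξ * z).val * p) hq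
      have l2 := Nat.mod_lt ((ξ * z').val * p) hq
      simp only [arc] at hξ
      rw [hξ] at e1
      set x := (ξ * z).val
      set y := (ξ * z').val
      have key : ∀ u v : ℕ, u * p < v * p + q → (u : ℤ) - v ≤ ((q / p : ℕ) : ℤ) := by
        intro u v huv
        rcases le_or_gt u v with h | h
        · have : (0 : ℤ) ≤ ((q / p : ℕ) : ℤ) := Int.natCast_nonneg _
          omega
        · have : u - v ≤ q / p := by
            rw [Nat.le_div_iff_mul_le hp, Nat.sub_mul]
            omega
          omega
      have k1 := key x y (by omega)
      have k2 := key y x (by omega)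
      simp only [coe_Icc, Set.mem_Icc]
      constructor <;> linarith
    · intro ξ _ ξ' _ hh
      have h2 : (((ξ * z).val - (ξ * z').val : ℤ) : ZMod q) =
          (((ξ' * z).val - (ξ' * z').val : ℤ) : ZMod q) := congrArg _ hh
      push_cast at h2
      simp only [ZMod.natCast_val, ZMod.cast_id', id] at h2
      exact mul_right_cancel₀ (sub_ne_zero.2 hz) (by linear_combination h2)
  rw [Int.card_Icc] at h
  have h2 : #{ξ : ZMod q | arc p (ξ * z) = arc p (ξ * z')} ≤ 2 * (q / p) + 1 := by omega
  calc _ ≤ (2 * (q / p) + 1) * p := Nat.mul_le_mul_right _ h2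
    _ = 2 * (q / p * p) + p := by ring
    _ ≤ 3 * q := by
      have := Nat.div_mul_le_self q p
      omega

lemma card_sq_le_card_image_mul {α β : Type*} [DecidableEq α] [DecidableEq β] (A : Finset α)
    (g : α → β) : #A ^ 2 ≤ #(A.image g) * #{q ∈ A ×ˢ A | g q.1 = g q.2} := by
  have h1 : #A = ∑ x ∈ A.image g, #{a ∈ A | g a = x} :=
    card_eq_sum_card_fiberwise fun a ha => mem_image_of_mem g ha
  have h2 : #{q ∈ A ×ˢ A | g q.1 = g q.2} = ∑ x ∈ A.image g, #{a ∈ A | g a = x} ^ 2 := by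
    rw [card_eq_sum_card_fiberwise (f := fun q : α × α => g q.1) (t := A.image g)
      (fun q hq => mem_image_of_mem g (mem_product.1 (mem_filter.1 (mem_coe.1 hq)).1).1)]
    refine sum_congr rfl fun x _ => ?_
    rw [sq, ← card_product]
    congr 1
    ext q
    simp only [mem_filter, mem_product]
    constructor
    · rintro ⟨⟨⟨h1, h2⟩, h3⟩, h4⟩
      exact ⟨⟨h1, h4⟩, h2, h3 ▸ h4⟩
    · rintro ⟨⟨h1, h2⟩, h3, h4⟩
      exact ⟨⟨⟨h1, h3⟩, h2.trans h4.symm⟩, h2⟩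
  rw [h2]
  nth_rewrite 1 [h1]
  exact sq_sum_le_card_mul_sum_sq

/-- A positive proportion of `A` embeds in `(ZMod p)²`, preserving the additive quadruples of
`f`. -/
lemma exists_freiman_embedding (A : Finset ℂ) (f : ℂ → ℂ) (hf : Set.InjOn f A) {p : ℕ}
    (hp : 0 < p) (hAp : #A ≤ p ^ 2) :
    ∃ B ⊆ A, #A ≤ 160 * #B ∧ ∃ g : ℂ → ZMod p × ZMod p, Set.InjOn g B ∧
      ∀ a ∈ B, ∀ b ∈ B, ∀ c ∈ B, ∀ d ∈ B, f a + f b = f c + f d → g a + g b = g c + g d := by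
  obtain ⟨ψ, hψ, hadd⟩ := exists_int_freiman (A.image f)
  obtain ⟨q, hq, hqp⟩ := Nat.exists_infinite_primes
    (p + 1 + ∑ r ∈ A ×ˢ A, (ψ (f r.1) - ψ (f r.2)).natAbs)
  have : Fact q.Prime := ⟨hqp⟩
  have hpq : p ≤ q := by omega
  have hq0 : 0 < q := hqp.pos
  set z : ℂ → ZMod q := fun a => (ψ (f a) : ZMod q) with hz
  have hzinj : Set.InjOn z A := by
    intro a ha b hb hab
    have hd := (ZMod.intCast_eq_intCast_iff_dvd_sub _ _ _).1 hab
    have hlt : |ψ (f b) - ψ (f a)| < (q : ℤ) := by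
      rw [Int.abs_eq_natAbs]
      have := single_le_sum (f := fun r : ℂ × ℂ => (ψ (f r.1) - ψ (f r.2)).natAbs)
        (fun _ _ => Nat.zero_le _) (mem_product.2 ⟨hb, ha⟩ : (b, a) ∈ A ×ˢ A)
      simp only at this
      omega
    have h0 := Int.eq_zero_of_abs_lt_dvd hd hlt
    exact hf ha hb (hψ (mem_coe.2 (mem_image_of_mem f ha)) (mem_coe.2 (mem_image_of_mem f hb))
      (by linarith))
  set G : ZMod q × ZMod q → ℂ → ℕ × ℕ := fun ξ a => (arc p (ξ.1 * z a), arc p (ξ.2 * z a)) with hG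
  set n := #A with hn
  have hpair : ∀ r ∈ A ×ˢ A, #{ξ : ZMod q × ZMod q | G ξ r.1 = G ξ r.2} * p ^ 2 ≤
      (if r.1 = r.2 then p ^ 2 * q ^ 2 else 0) + 9 * q ^ 2 := by
    intro r hr
    obtain ⟨h1, h2⟩ := mem_product.1 hr
    by_cases h : r.1 = r.2
    · rw [if_pos h]
      have : #{ξ : ZMod q × ZMod q | G ξ r.1 = G ξ r.2} ≤ q ^ 2 := by
        refine (card_filter_le _ _).trans ?_
        rw [card_univ, Fintype.card_prod, ZMod.card, sq]
      calc _ ≤ q ^ 2 * p ^ 2 := Nat.mul_le_mul_right _ this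
        _ = p ^ 2 * q ^ 2 := mul_comm _ _
        _ ≤ _ := Nat.le_add_right _ _
    · rw [if_neg h, zero_add]
      have hc := card_arc_eq_mul_le hp hpq (fun e => h (hzinj h1 h2 e))
      set K := ({ξ : ZMod q | arc p (ξ * z r.1) = arc p (ξ * z r.2)} : Finset (ZMod q))
      have : #{ξ : ZMod q × ZMod q | G ξ r.1 = G ξ r.2} ≤ #(K ×ˢ K) := by
        refine card_le_card fun ξ hξ => ?_
        obtain ⟨e1, e2⟩ := Prod.mk.inj (mem_filter.1 hξ).2
        exact mem_product.2 ⟨mem_filter.2 ⟨mem_univ _, e1⟩, mem_filter.2 ⟨mem_univ _, e2⟩⟩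
      rw [card_product] at this
      calc _ ≤ #K * #K * p ^ 2 := Nat.mul_le_mul_right _ this
        _ = (#K * p) * (#K * p) := by ring
        _ ≤ (3 * q) * (3 * q) := Nat.mul_le_mul hc hc
        _ = 9 * q ^ 2 := by ring
  have htot : ∑ ξ : ZMod q × ZMod q, #{r ∈ A ×ˢ A | G ξ r.1 = G ξ r.2} ≤
      ∑ ξ : ZMod q × ZMod q, 10 * n := by
    have hsw := sum_card_bipartiteAbove_eq_sum_card_bipartiteBelow
      (s := (univ : Finset (ZMod q × ZMod q))) (t := A ×ˢ A) (fun ξ r => G ξ r.1 = G ξ r.2)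
    simp only [bipartiteAbove, bipartiteBelow] at hsw
    rw [hsw, sum_const, card_univ, Fintype.card_prod, ZMod.card, smul_eq_mul]
    refine le_of_mul_le_mul_right ?_ (pow_pos hp 2)
    rw [sum_mul]
    have hdiag : ∑ r ∈ A ×ˢ A, (if r.1 = r.2 then p ^ 2 * q ^ 2 else 0) = n * (p ^ 2 * q ^ 2) := by
      have hc : n * (p ^ 2 * q ^ 2) = ∑ a ∈ A, p ^ 2 * q ^ 2 := by rw [sum_const, smul_eq_mul]
      rw [sum_product, hc]
      refine sum_congr rfl fun a ha => ?_
      simp [ha]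
    calc _ ≤ ∑ r ∈ A ×ˢ A, ((if r.1 = r.2 then p ^ 2 * q ^ 2 else 0) + 9 * q ^ 2) :=
          sum_le_sum hpair
      _ = n * (p ^ 2 * q ^ 2) + n * n * (9 * q ^ 2) := by
          rw [sum_add_distrib, hdiag, sum_const, card_product, smul_eq_mul]
      _ ≤ n * (p ^ 2 * q ^ 2) + n * p ^ 2 * (9 * q ^ 2) := by gcongr
      _ = _ := by ring
  obtain ⟨ξ, -, hξ⟩ := exists_le_of_sum_le univ_nonempty htot
  set κ : ℂ → Bool × Bool := fun a => (inUpperHalf p (ξ.1 * z a), inUpperHalf p (ξ.2 * z a)) with hκ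
  obtain ⟨u, -, hu⟩ := exists_le_of_sum_le (s := (univ : Finset (Bool × Bool)))
    (f := fun _ => n) (g := fun u => 4 * #{a ∈ A | κ a = u}) univ_nonempty (by
      rw [← mul_sum, ← card_eq_sum_card_fiberwise (f := κ) (fun _ _ => mem_coe.2 (mem_univ _))]
      simp [hn])
  set A₁ := ({a ∈ A | κ a = u} : Finset ℂ) with hA₁
  have hA₁A : A₁ ⊆ A := filter_subset _ _
  have hcs := card_sq_le_card_image_mul A₁ (G ξ)
  have hcol : #{r ∈ A₁ ×ˢ A₁ | G ξ r.1 = G ξ r.2} ≤ 10 * n :=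
    (card_le_card (filter_subset_filter _ (product_subset_product hA₁A hA₁A))).trans hξ
  obtain ⟨B, hB, hBinj, hBimg⟩ := exists_subset_injOn_image_eq_of_surjOn (f := G ξ) A₁ (A₁.image (G ξ))
    (by intro x hx; simpa using hx)
  have hBcard : #B = #(A₁.image (G ξ)) := by rw [← hBimg, card_image_of_injOn hBinj]
  have hBA₁ : B ⊆ A₁ := by exact_mod_cast hB
  refine ⟨B, hBA₁.trans hA₁A, ?_, fun a => ((G ξ a).1, (G ξ a).2), ?_, ?_⟩
  · rw [← hBcard] at hcs
    rcases Nat.eq_zero_or_pos n with h0 | h0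
    · omega
    refine le_of_mul_le_mul_right (a := n) ?_ h0
    calc n * n ≤ (4 * #A₁) * (4 * #A₁) := Nat.mul_le_mul hu hu
      _ = 16 * #A₁ ^ 2 := by ring
      _ ≤ 16 * (#B * (10 * n)) := by
        refine Nat.mul_le_mul_left _ (hcs.trans (Nat.mul_le_mul_left _ hcol))
      _ = 160 * #B * n := by ring
  · intro a ha b hb hab
    obtain ⟨e1, e2⟩ := Prod.mk.inj hab
    have key : ∀ x y : ZMod q, (arc p x : ZMod p) = arc p y → arc p x = arc p y := by
      intro x y h
      have := (ZMod.natCast_eq_natCast_iff' _ _ _).1 h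
      rwa [Nat.mod_eq_of_lt (arc_lt hp x), Nat.mod_eq_of_lt (arc_lt hp y)] at this
    exact hBinj ha hb (Prod.ext (key _ _ e1) (key _ _ e2))
  · intro a ha b hb c hc d hd h
    have mA : ∀ x ∈ B, f x ∈ A.image f := fun x hx => mem_image_of_mem f (hA₁A (hBA₁ hx))
    have hz4 : z a + z b = z c + z d := by
      simp only [hz]
      exact_mod_cast congrArg (Int.cast : ℤ → ZMod q)
        (hadd _ (mA a ha) _ (mA b hb) _ (mA c hc) _ (mA d hd) h)
    have hu1 : ∀ x ∈ B, inUpperHalf p (ξ.1 * z x) = u.1 ∧ inUpperHalf p (ξ.2 * z x) = u.2 := by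
      intro x hx
      have := (mem_filter.1 (hBA₁ hx)).2
      rw [← this]
      exact ⟨rfl, rfl⟩
    refine Prod.ext ?_ ?_
    · exact arc_add_eq (by rw [← mul_add, ← mul_add, hz4]) (hu1 a ha).1 (hu1 b hb).1 (hu1 c hc).1
        (hu1 d hd).1
    · exact arc_add_eq (by rw [← mul_add, ← mul_add, hz4]) (hu1 a ha).2 (hu1 b hb).2 (hu1 c hc).2
        (hu1 d hd).2

/-- `f` takes distinct values at distinct unordered pairs of elements of `S`, when added up. -/
def SidonFor (f : ℂ → ℂ) (S : Finset ℂ) : Prop :=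
  ∀ a ∈ S, ∀ b ∈ S, ∀ c ∈ S, ∀ d ∈ S, f a + f b = f c + f d → a = c ∧ b = d ∨ a = d ∧ b = c

/-- The coefficients of a cubic polynomial. -/
abbrev CubicCoeffs (F : Type*) := F × F × F × F

/-- The value of a cubic polynomial at a point. -/
def cubicEval {F : Type*} [Field F] (h : CubicCoeffs F) (x : F) : F :=
  h.1 * x ^ 3 + h.2.1 * x ^ 2 + h.2.2.1 * x + h.2.2.2

lemma cubic_ext_of_three {F : Type*} [Field F] {h h' : CubicCoeffs F} (h0 : h.1 = h'.1) {x y z : F}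
    (hxy : x ≠ y) (hxz : x ≠ z) (hyz : y ≠ z) (ex : cubicEval h x = cubicEval h' x)
    (ey : cubicEval h y = cubicEval h' y) (ez : cubicEval h z = cubicEval h' z) : h = h' := by
  obtain ⟨a, b, c, d⟩ := h
  obtain ⟨a', b', c', d'⟩ := h'
  simp only at h0
  subst h0
  simp only [cubicEval] at ex ey ez
  have e1 : (b - b') * (x + y) + (c - c') = 0 :=
    mul_left_cancel₀ (sub_ne_zero.2 hxy) (by linear_combination ex - ey)
  have e2 : (b - b') * (x + z) + (c - c') = 0 :=
    mul_left_cancel₀ (sub_ne_zero.2 hxz) (by linear_combination ex - ez)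
  have e3 : b - b' = 0 := mul_left_cancel₀ (sub_ne_zero.2 hyz) (by linear_combination e1 - e2)
  obtain rfl := sub_eq_zero.1 e3
  have e4 : c = c' := by linear_combination e1
  subst e4
  have e5 : d = d' := by linear_combination ex
  rw [e5]

lemma cubic_ext_of_four {F : Type*} [Field F] {h h' : CubicCoeffs F} {x y z w : F}
    (hxy : x ≠ y) (hxz : x ≠ z) (hyz : y ≠ z) (hxw : x ≠ w) (hyw : y ≠ w) (hzw : z ≠ w)
    (ex : cubicEval h x = cubicEval h' x) (ey : cubicEval h y = cubicEval h' y)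
    (ez : cubicEval h z = cubicEval h' z) (ew : cubicEval h w = cubicEval h' w) : h = h' := by
  refine cubic_ext_of_three ?_ hxy hxz hyz ex ey ez
  obtain ⟨a, b, c, d⟩ := h
  obtain ⟨a', b', c', d'⟩ := h'
  simp only [cubicEval] at ex ey ez ew ⊢
  have q : ∀ t : F, x ≠ t → a * t ^ 3 + b * t ^ 2 + c * t + d = a' * t ^ 3 + b' * t ^ 2 + c' * t + d' →
      (a - a') * (x ^ 2 + x * t + t ^ 2) + (b - b') * (x + t) + (c - c') = 0 := fun t ht et =>
    mul_left_cancel₀ (sub_ne_zero.2 ht) (by linear_combination ex - et)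
  have r : ∀ t : F, x ≠ t → y ≠ t →
      a * t ^ 3 + b * t ^ 2 + c * t + d = a' * t ^ 3 + b' * t ^ 2 + c' * t + d' →
      (a - a') * (x + y + t) + (b - b') = 0 := fun t ht ht' et =>
    mul_left_cancel₀ (sub_ne_zero.2 ht') (by linear_combination q y hxy ey - q t ht et)
  have e : a - a' = 0 := mul_left_cancel₀ (sub_ne_zero.2 hzw)
    (by linear_combination r z hxz hyz ez - r w hxw hyw ew)
  exact sub_eq_zero.1 e

/-- The part of the graph of the cubic polynomial `h` over one half of `ZMod p`, the two halves
being exchanged by the central symmetry of the graph. -/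
def OnHalfCubic {p : ℕ} [Fact p.Prime] (h : CubicCoeffs (ZMod p)) (v : ZMod p × ZMod p) : Prop :=
  v.2 = cubicEval h v.1 ∧ 1 ≤ (3 * h.1 * v.1 + h.2.1).val ∧ 2 * (3 * h.1 * v.1 + h.2.1).val < p

lemma OnHalfCubic.sidon {p : ℕ} [Fact p.Prime] {h : CubicCoeffs (ZMod p)} {v₁ v₂ v₃ v₄ : ZMod p × ZMod p}
    (h₁ : OnHalfCubic h v₁) (h₂ : OnHalfCubic h v₂) (h₃ : OnHalfCubic h v₃)
    (h₄ : OnHalfCubic h v₄) (hv : v₁ + v₂ = v₃ + v₄) : v₁ = v₃ ∧ v₂ = v₄ ∨ v₁ = v₄ ∧ v₂ = v₃ := by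
  have hu : (3 * h.1 * v₁.1 + h.2.1) + (3 * h.1 * v₂.1 + h.2.1) ≠ 0 := by
    have l1 := h₁.2
    have l2 := h₂.2
    rw [← ZMod.natCast_zmod_val (3 * h.1 * v₁.1 + h.2.1),
      ← ZMod.natCast_zmod_val (3 * h.1 * v₂.1 + h.2.1), ← Nat.cast_add, Ne,
      ZMod.natCast_eq_zero_iff]
    intro hd
    have := Nat.le_of_dvd (by omega) hd
    omega
  have hx : v₁.1 + v₂.1 = v₃.1 + v₄.1 := congrArg Prod.fst hv
  have hy : v₁.2 + v₂.2 = v₃.2 + v₄.2 := congrArg Prod.snd hv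
  rw [h₁.1, h₂.1, h₃.1, h₄.1] at hy
  simp only [cubicEval] at hy
  have hx2 : v₂.1 = v₃.1 + v₄.1 - v₁.1 := by linear_combination hx
  have key : ((3 * h.1 * v₁.1 + h.2.1) + (3 * h.1 * v₂.1 + h.2.1)) *
      ((v₁.1 - v₃.1) * (v₁.1 - v₄.1)) = 0 := by
    rw [hx2] at hy ⊢
    linear_combination hy
  rcases mul_eq_zero.1 ((mul_eq_zero.1 key).resolve_left hu) with h0 | h0
  · left
    have e := sub_eq_zero.1 h0
    have e2 : v₂.1 = v₄.1 := by linear_combination hx - e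
    exact ⟨Prod.ext e (by rw [h₁.1, h₃.1, e]), Prod.ext e2 (by rw [h₂.1, h₄.1, e2])⟩
  · right
    have e := sub_eq_zero.1 h0
    have e2 : v₂.1 = v₃.1 := by linear_combination hx - e
    exact ⟨Prod.ext e (by rw [h₁.1, h₄.1, e]), Prod.ext e2 (by rw [h₂.1, h₃.1, e2])⟩

lemma OnHalfCubic.fst_ne {p : ℕ} [Fact p.Prime] {h : CubicCoeffs (ZMod p)} {v w : ZMod p × ZMod p}
    (hv : OnHalfCubic h v) (hw : OnHalfCubic h w) (hne : v ≠ w) : v.1 ≠ w.1 := fun e =>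
  hne (Prod.ext e (by rw [hv.1, hw.1, e]))

open Classical in
lemma cube_le_card_onHalfCubic {p : ℕ} [Fact p.Prime] (hp : 3 ≤ p) (v : ZMod p × ZMod p) :
    p ^ 3 ≤ 4 * #{h : CubicCoeffs (ZMod p) | OnHalfCubic h v} := by
  have hinj : #((univ : Finset (ZMod p × ZMod p)) ×ˢ range ((p - 1) / 2)) ≤
      #{h : CubicCoeffs (ZMod p) | OnHalfCubic h v} := by
    refine card_le_card_of_injOn (fun t => (t.1.1, ((t.2 + 1 : ℕ) : ZMod p) - 3 * t.1.1 * v.1, t.1.2,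
      v.2 - (t.1.1 * v.1 ^ 3 + (((t.2 + 1 : ℕ) : ZMod p) - 3 * t.1.1 * v.1) * v.1 ^ 2 +
        t.1.2 * v.1))) ?_ ?_
    · rintro ⟨⟨α, γ⟩, k⟩ ht
      have hk := mem_range.1 (mem_product.1 (mem_coe.1 ht)).2
      simp only at hk
      have hkv : ((k + 1 : ℕ) : ZMod p).val = k + 1 := ZMod.val_natCast_of_lt (by omega)
      refine mem_coe.2 (mem_filter.2 ⟨mem_univ _, ?_, ?_⟩)
      · simp only [cubicEval]
        ring
      · simp only [add_sub_cancel]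
        rw [hkv]
        omega
    · rintro ⟨⟨α, γ⟩, k⟩ ht ⟨⟨α', γ'⟩, k'⟩ ht' h
      have hk := mem_range.1 (mem_product.1 (mem_coe.1 ht)).2
      have hk' := mem_range.1 (mem_product.1 (mem_coe.1 ht')).2
      simp only [Prod.mk.injEq] at h hk hk'
      obtain ⟨rfl, h2, rfl, -⟩ := h
      have h3 := congrArg ZMod.val (sub_left_inj.1 h2)
      rw [ZMod.val_natCast_of_lt (by omega), ZMod.val_natCast_of_lt (by omega)] at h3
      simp only [Prod.mk.injEq, true_and]
      omega
  rw [card_product, card_univ, Fintype.card_prod, ZMod.card, card_range] at hinj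
  have hodd : p ≤ 4 * ((p - 1) / 2) := by omega
  calc p ^ 3 = p * p * p := by ring
    _ ≤ p * p * (4 * ((p - 1) / 2)) := Nat.mul_le_mul_left _ hodd
    _ = 4 * (p * p * ((p - 1) / 2)) := by ring
    _ ≤ _ := Nat.mul_le_mul_left _ hinj

/-- A set with few additive quadruples for `f₂` has a large subset which is Sidon for both `f₁`
and `f₂`, provided that it embeds in `(ZMod p)²` along `f₁`. -/
lemma exists_sidonFor_of_embedding {p : ℕ} [Fact p.Prime] (hp3 : 3 ≤ p) (B : Finset ℂ)
    (f₁ f₂ : ℂ → ℂ) (hf₂ : Set.InjOn f₂ B) (g : ℂ → ZMod p × ZMod p) (hg : Set.InjOn g B)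
    (hfg : ∀ a ∈ B, ∀ b ∈ B, ∀ c ∈ B, ∀ d ∈ B, f₁ a + f₁ b = f₁ c + f₁ d → g a + g b = g c + g d)
    (hpB : 32 * #B ≤ p ^ 2) (hpE : 16 * energy f₂ B ≤ #B * p ^ 3) :
    ∃ S ⊆ B, #B ≤ 8 * p * #S ∧ SidonFor f₁ S ∧ SidonFor f₂ S := by
  classical
  set n := #B with hn
  set S₀ : CubicCoeffs (ZMod p) → Finset ℂ := fun h => {a ∈ B | OnHalfCubic h (g a)} with hS₀
  set bad : Finset ((ℂ × ℂ) × (ℂ × ℂ)) :=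
    {q ∈ (B ×ˢ B) ×ˢ (B ×ˢ B) | f₂ q.1.1 + f₂ q.2.1 = f₂ q.1.2 + f₂ q.2.2 ∧
      ¬ (q.1.1 = q.1.2 ∧ q.2.1 = q.2.2 ∨ q.1.1 = q.2.2 ∧ q.2.1 = q.1.2)} with hbad
  set badIn : CubicCoeffs (ZMod p) → Finset ((ℂ × ℂ) × (ℂ × ℂ)) := fun h =>
    {q ∈ bad | (OnHalfCubic h (g q.1.1) ∧ OnHalfCubic h (g q.1.2)) ∧
      OnHalfCubic h (g q.2.1) ∧ OnHalfCubic h (g q.2.2)} with hbadIn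
  have hbadE : #bad ≤ energy f₂ B := by
    refine card_le_card fun q hq => ?_
    obtain ⟨h1, h2⟩ := mem_filter.1 hq
    exact mem_filter.2 ⟨h1, h2.1⟩
  have hH : Fintype.card (CubicCoeffs (ZMod p)) = p ^ 4 := by
    simp only [Fintype.card_prod, ZMod.card]
    ring
  have hcount : ∀ q ∈ bad, #{h : CubicCoeffs (ZMod p) | (OnHalfCubic h (g q.1.1) ∧
      OnHalfCubic h (g q.1.2)) ∧ OnHalfCubic h (g q.2.1) ∧ OnHalfCubic h (g q.2.2)} ≤
      1 + if q.1.1 = q.2.1 ∨ q.1.2 = q.2.2 then p else 0 := by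
    rintro ⟨⟨a, c⟩, ⟨b, d⟩⟩ hq
    obtain ⟨hm, heq, hnt⟩ := mem_filter.1 hq
    simp only [mem_product] at hm heq hnt ⊢
    obtain ⟨⟨ha, hc⟩, hb, hd⟩ := hm
    push Not at hnt
    have hac : a ≠ c := by
      rintro rfl
      exact hnt.1 rfl (hf₂ hb hd (by linear_combination heq))
    have had : a ≠ d := by
      rintro rfl
      exact hnt.2 rfl (hf₂ hb hc (by linear_combination heq))
    have hbc : b ≠ c := by
      rintro rfl
      exact hnt.2 (hf₂ ha hd (by linear_combination heq)) rfl
    have hbd : b ≠ d := by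
      rintro rfl
      exact hnt.1 (hf₂ ha hc (by linear_combination heq)) rfl
    have gne : ∀ x ∈ B, ∀ y ∈ B, x ≠ y → g x ≠ g y := fun x hx y hy h e => h (hg hx hy e)
    have three : ∀ x ∈ B, ∀ y ∈ B, ∀ z ∈ B, x ≠ y → x ≠ z → y ≠ z →
        #{h : CubicCoeffs (ZMod p) | OnHalfCubic h (g x) ∧ OnHalfCubic h (g y) ∧ OnHalfCubic h (g z)} ≤
          p := by
      intro x hx y hy z hz hxy hxz hyz
      have hcard : #(univ : Finset (ZMod p)) = p := by rw [card_univ, ZMod.card]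
      conv_rhs => rw [← hcard]
      refine card_le_card_of_injOn Prod.fst (fun _ _ => mem_coe.2 (mem_univ _)) ?_
      intro h hh h' hh' e
      obtain ⟨e1, e2, e3⟩ := (mem_filter.1 (mem_coe.1 hh)).2
      obtain ⟨e1', e2', e3'⟩ := (mem_filter.1 (mem_coe.1 hh')).2
      exact cubic_ext_of_three e (e1.fst_ne e2 (gne x hx y hy hxy)) (e1.fst_ne e3 (gne x hx z hz hxz))
        (e2.fst_ne e3 (gne y hy z hz hyz)) (e1.1.symm.trans e1'.1) (e2.1.symm.trans e2'.1)
        (e3.1.symm.trans e3'.1)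
    by_cases hab : a = b
    · have hcd : c ≠ d := by
        rintro rfl
        subst hab
        exact hac (hf₂ ha hc (by linear_combination heq / 2))
      rw [if_pos (Or.inl hab)]
      refine le_trans (card_le_card fun h hh => ?_)
        ((three a ha c hc d hd hac had hcd).trans (Nat.le_add_left _ _))
      obtain ⟨⟨e1, e2⟩, e3, e4⟩ := (mem_filter.1 hh).2
      exact mem_filter.2 ⟨mem_univ _, e1, e2, e4⟩
    · by_cases hcd : c = d
      · rw [if_pos (Or.inr hcd)]
        refine le_trans (card_le_card fun h hh => ?_)
          ((three a ha b hb c hc hab hac hbc).trans (Nat.le_add_left _ _))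
        obtain ⟨⟨e1, e2⟩, e3, e4⟩ := (mem_filter.1 hh).2
        exact mem_filter.2 ⟨mem_univ _, e1, e3, e2⟩
      · rw [if_neg (by tauto), add_zero, card_le_one]
        intro h hh h' hh'
        obtain ⟨⟨e1, e2⟩, e3, e4⟩ := (mem_filter.1 hh).2
        obtain ⟨⟨e1', e2'⟩, e3', e4'⟩ := (mem_filter.1 hh').2
        exact cubic_ext_of_four (e1.fst_ne e2 (gne a ha c hc hac)) (e1.fst_ne e3 (gne a ha b hb hab))
          (e2.fst_ne e3 (gne c hc b hb hbc.symm)) (e1.fst_ne e4 (gne a ha d hd had))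
          (e2.fst_ne e4 (gne c hc d hd hcd)) (e3.fst_ne e4 (gne b hb d hd hbd))
          (e1.1.symm.trans e1'.1) (e2.1.symm.trans e2'.1) (e3.1.symm.trans e3'.1)
          (e4.1.symm.trans e4'.1)
  have hdeg : #{q ∈ bad | q.1.1 = q.2.1 ∨ q.1.2 = q.2.2} ≤ 2 * n ^ 2 := by
    have hsub : ∀ R : (ℂ × ℂ) × (ℂ × ℂ) → Prop, (∀ q ∈ bad, ∀ q' ∈ bad, R q → R q' → q.1 = q'.1 →
        q.2 = q'.2) → #{q ∈ bad | R q} ≤ n ^ 2 := by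
      intro R hR
      rw [sq, hn, ← card_product]
      refine card_le_card_of_injOn Prod.fst ?_ ?_
      · intro q hq
        exact (mem_product.1 (mem_filter.1 (mem_filter.1 (mem_coe.1 hq)).1).1).1
      · intro q hq q' hq' e
        obtain ⟨m1, r1⟩ := mem_filter.1 (mem_coe.1 hq)
        obtain ⟨m2, r2⟩ := mem_filter.1 (mem_coe.1 hq')
        exact Prod.ext e (hR q m1 q' m2 r1 r2 e)
    have hmem : ∀ q ∈ bad, q.2.1 ∈ B ∧ q.2.2 ∈ B ∧ f₂ q.1.1 + f₂ q.2.1 = f₂ q.1.2 + f₂ q.2.2 := by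
      intro q hq
      obtain ⟨h1, h2, -⟩ := mem_filter.1 hq
      have := mem_product.1 (mem_product.1 h1).2
      exact ⟨this.1, this.2, h2⟩
    rw [filter_or, two_mul]
    refine (card_union_le _ _).trans (Nat.add_le_add (hsub _ ?_) (hsub _ ?_))
    · intro q hq q' hq' r r' e
      obtain ⟨-, m2, m3⟩ := hmem q hq
      obtain ⟨-, m2', m3'⟩ := hmem q' hq'
      have e1 : q.2.1 = q'.2.1 := by rw [← r, ← r', e]
      refine Prod.ext e1 (hf₂ m2 m2' ?_)
      rw [e, e1] at m3
      linear_combination m3' - m3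
    · intro q hq q' hq' r r' e
      obtain ⟨m1, -, m3⟩ := hmem q hq
      obtain ⟨m1', -, m3'⟩ := hmem q' hq'
      have e1 : q.2.2 = q'.2.2 := by rw [← r, ← r', e]
      refine Prod.ext (hf₂ m1 m1' ?_) e1
      rw [e, e1] at m3
      linear_combination m3 - m3'
  have hsumbad : ∑ h, #(badIn h) ≤ energy f₂ B + 2 * n ^ 2 * p := by
    have hsw := sum_card_bipartiteAbove_eq_sum_card_bipartiteBelow
      (s := (univ : Finset (CubicCoeffs (ZMod p)))) (t := bad) (fun h q =>
        (OnHalfCubic h (g q.1.1) ∧ OnHalfCubic h (g q.1.2)) ∧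
        OnHalfCubic h (g q.2.1) ∧ OnHalfCubic h (g q.2.2))
    simp only [bipartiteAbove, bipartiteBelow] at hsw
    calc ∑ h, #(badIn h) = _ := hsw
      _ ≤ ∑ q ∈ bad, (1 + if q.1.1 = q.2.1 ∨ q.1.2 = q.2.2 then p else 0) := sum_le_sum hcount
      _ = #bad + #{q ∈ bad | q.1.1 = q.2.1 ∨ q.1.2 = q.2.2} * p := by
        rw [sum_add_distrib, ← sum_filter, sum_const, sum_const, smul_eq_mul, smul_eq_mul, mul_one]
      _ ≤ _ := Nat.add_le_add hbadE (Nat.mul_le_mul_right _ hdeg)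
  have hsumgood : n * p ^ 3 ≤ 4 * ∑ h, #(S₀ h) := by
    have hsw := sum_card_bipartiteAbove_eq_sum_card_bipartiteBelow
      (s := (univ : Finset (CubicCoeffs (ZMod p)))) (t := B) (fun h a => OnHalfCubic h (g a))
    simp only [bipartiteAbove, bipartiteBelow] at hsw
    rw [hsw, mul_sum, hn, ← smul_eq_mul, ← sum_const]
    exact sum_le_sum fun a _ => cube_le_card_onHalfCubic hp3 (g a)
  obtain ⟨h, -, hh⟩ := exists_le_of_sum_le (s := (univ : Finset (CubicCoeffs (ZMod p))))
    (f := fun h => 8 * p * #(badIn h) + n) (g := fun h => 8 * p * #(S₀ h)) univ_nonempty (by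
      rw [sum_add_distrib, ← mul_sum, ← mul_sum, sum_const, card_univ, hH, smul_eq_mul]
      have h1 : 8 * p * ∑ h, #(badIn h) ≤ 8 * p * (energy f₂ B + 2 * n ^ 2 * p) :=
        Nat.mul_le_mul_left _ hsumbad
      have h2 : 2 * p * (n * p ^ 3) ≤ 2 * p * (4 * ∑ h, #(S₀ h)) := Nat.mul_le_mul_left _ hsumgood
      have h3 : p * (16 * energy f₂ B) ≤ p * (n * p ^ 3) := Nat.mul_le_mul_left _ hpE
      have h4 : (n * p ^ 2) * (32 * n) ≤ (n * p ^ 2) * p ^ 2 := Nat.mul_le_mul_left _ hpB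
      nlinarith)
  refine ⟨S₀ h \ (badIn h).image (fun q => q.1.1), sdiff_subset.trans (filter_subset _ _), ?_, ?_, ?_⟩
  · have h1 := le_card_sdiff ((badIn h).image (fun q => q.1.1)) (S₀ h)
    have h2 : #((badIn h).image (fun q => q.1.1)) ≤ #(badIn h) := card_image_le
    have h3 : #(S₀ h) ≤ #(S₀ h \ (badIn h).image (fun q => q.1.1)) + #(badIn h) := by omega
    have h4 := Nat.mul_le_mul_left (8 * p) h3
    rw [mul_add] at h4
    omega
  · intro a ha b hb c hc d hd heq
    have m : ∀ x ∈ S₀ h \ (badIn h).image (fun q => q.1.1), x ∈ B ∧ OnHalfCubic h (g x) :=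
      fun x hx => mem_filter.1 (mem_sdiff.1 hx).1
    have := OnHalfCubic.sidon (m a ha).2 (m b hb).2 (m c hc).2 (m d hd).2
      (hfg a (m a ha).1 b (m b hb).1 c (m c hc).1 d (m d hd).1 heq)
    exact this.imp (fun e => ⟨hg (m a ha).1 (m c hc).1 e.1, hg (m b hb).1 (m d hd).1 e.2⟩)
      (fun e => ⟨hg (m a ha).1 (m d hd).1 e.1, hg (m b hb).1 (m c hc).1 e.2⟩)
  · intro a ha b hb c hc d hd heq
    have m : ∀ x ∈ S₀ h \ (badIn h).image (fun q => q.1.1), x ∈ B ∧ OnHalfCubic h (g x) :=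
      fun x hx => mem_filter.1 (mem_sdiff.1 hx).1
    by_contra hnt
    refine (mem_sdiff.1 ha).2 (mem_image.2 ⟨((a, c), (b, d)), mem_filter.2 ⟨mem_filter.2 ⟨?_, heq, hnt⟩,
      ⟨(m a ha).2, (m c hc).2⟩, (m b hb).2, (m d hd).2⟩, rfl⟩)
    exact mem_product.2 ⟨mem_product.2 ⟨(m a ha).1, (m c hc).1⟩,
      mem_product.2 ⟨(m b hb).1, (m d hd).1⟩⟩

section Subadditivity

open scoped Pointwise

/-- The number of representations of `s` as a sum of an element of `A` and an element of `B`. -/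
noncomputable def sumRep (A B : Finset ℂ) (s : ℂ) : ℕ := #{q ∈ A ×ˢ B | q.1 + q.2 = s}

/-- The number of representations of `d` as a difference of two elements of `A`. -/
noncomputable def diffRep (A : Finset ℂ) (d : ℂ) : ℕ := #{q ∈ A ×ˢ A | q.1 - q.2 = d}

lemma diffRep_eq_swap (A : Finset ℂ) (d : ℂ) :
    #{q ∈ A ×ˢ A | q.2 - q.1 = d} = diffRep A d :=
  card_equiv (Equiv.prodComm _ _) (by simp [and_comm])

lemma card_filter_eq_sum_mul {ι κ : Type*} (S : Finset ι) (T : Finset κ) (φ : ι → ℂ) (ψ : κ → ℂ)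
    (U : Finset ℂ) (hU : ∀ i ∈ S, φ i ∈ U) :
    #{q ∈ S ×ˢ T | φ q.1 = ψ q.2} = ∑ u ∈ U, #{i ∈ S | φ i = u} * #{j ∈ T | ψ j = u} := by
  rw [card_eq_sum_card_fiberwise (f := fun q => φ q.1) (t := U)
    (fun q hq => hU _ (mem_product.1 (mem_filter.1 (mem_coe.1 hq)).1).1)]
  refine sum_congr rfl fun u _ => ?_
  rw [← card_product]
  congr 1
  ext q
  simp only [mem_filter, mem_product]
  constructor
  · rintro ⟨⟨⟨h1, h2⟩, h3⟩, rfl⟩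
    exact ⟨⟨h1, rfl⟩, h2, h3.symm⟩
  · rintro ⟨⟨h1, rfl⟩, h2, h3⟩
    exact ⟨⟨⟨h1, h2⟩, h3.symm⟩, rfl⟩

lemma addEnergy_eq_sum_diffRep_mul (A B U : Finset ℂ) (hU : A - A ⊆ U) :
    Finset.addEnergy A B = ∑ d ∈ U, diffRep A d * diffRep B d := by
  simp_rw [← diffRep_eq_swap B]
  simp only [diffRep]
  rw [← card_filter_eq_sum_mul (A ×ˢ A) (B ×ˢ B) (fun q => q.1 - q.2)
    (fun q => q.2 - q.1) U fun q hq => hU (sub_mem_sub (mem_product.1 hq).1 (mem_product.1 hq).2)]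
  unfold Finset.addEnergy
  congr 1
  refine filter_congr fun q _ => ?_
  rw [sub_eq_sub_iff_add_eq_add, add_comm q.2.2]

lemma addEnergy_sq_le (A B : Finset ℂ) :
    Finset.addEnergy A B ^ 2 ≤ energy id A * energy id B := by
  have hA := addEnergy_eq_sum_diffRep_mul A A ((A - A) ∪ (B - B)) subset_union_left
  have hB := addEnergy_eq_sum_diffRep_mul B B ((A - A) ∪ (B - B)) subset_union_right
  have hAB := addEnergy_eq_sum_diffRep_mul A B ((A - A) ∪ (B - B)) subset_union_left
  rw [show energy id A = Finset.addEnergy A A from rfl,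
    show energy id B = Finset.addEnergy B B from rfl, hA, hB, hAB]
  simpa only [sq] using sum_mul_sq_le_sq_mul_sq ((A - A) ∪ (B - B)) (diffRep A) (diffRep B)

lemma addEnergy_eq_sum_sumRep_sq (A B U : Finset ℂ) (hU : A + B ⊆ U) :
    Finset.addEnergy A B = ∑ s ∈ U, sumRep A B s ^ 2 := by
  rw [Finset.addEnergy_eq_sum_sq']
  refine sum_subset hU fun s _ hs => ?_
  rw [card_eq_zero.2, zero_pow two_ne_zero]
  refine filter_eq_empty_iff.2 fun q hq h => hs ?_
  rw [← h]
  exact add_mem_add (mem_product.1 hq).1 (mem_product.1 hq).2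

lemma sumRep_union_le (A B : Finset ℂ) (s : ℂ) :
    sumRep (A ∪ B) (A ∪ B) s ≤ sumRep A A s + 2 * sumRep A B s + sumRep B B s := by
  have h : sumRep B A s = sumRep A B s :=
    card_equiv (Equiv.prodComm _ _) (by simp [and_comm, add_comm])
  have : sumRep (A ∪ B) (A ∪ B) s ≤
      sumRep A A s + sumRep A B s + sumRep B A s + sumRep B B s := by
    unfold sumRep
    refine le_trans (card_le_card (t := ((({q ∈ A ×ˢ A | q.1 + q.2 = s} : Finset (ℂ × ℂ)) ∪
      {q ∈ A ×ˢ B | q.1 + q.2 = s}) ∪ {q ∈ B ×ˢ A | q.1 + q.2 = s}) ∪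
      {q ∈ B ×ˢ B | q.1 + q.2 = s}) fun q hq => ?_) ?_
    · simp only [mem_filter, mem_product, mem_union] at hq ⊢
      tauto
    · refine (card_union_le _ _).trans (Nat.add_le_add_right ?_ _)
      refine (card_union_le _ _).trans (Nat.add_le_add_right ?_ _)
      exact card_union_le _ _
  omega

lemma sum_mul_le_of_sum_sq_le {ι : Type*} (U : Finset ι) (f g : ι → ℝ) {a b : ℝ} (ha : 0 ≤ a)
    (hb : 0 ≤ b) (hf : ∑ i ∈ U, f i ^ 2 ≤ a ^ 2) (hg : ∑ i ∈ U, g i ^ 2 ≤ b ^ 2) :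
    ∑ i ∈ U, f i * g i ≤ a * b := by
  refine abs_le_of_sq_le_sq' ?_ (mul_nonneg ha hb) |>.2
  calc _ ≤ (∑ i ∈ U, f i ^ 2) * ∑ i ∈ U, g i ^ 2 := sum_mul_sq_le_sq_mul_sq U f g
    _ ≤ a ^ 2 * b ^ 2 := mul_le_mul hf hg (sum_nonneg fun i _ => sq_nonneg _) (sq_nonneg _)
    _ = _ := by ring

/-- The fourth root of the additive energy is subadditive. -/
lemma energy_union_le (A B : Finset ℂ) {x y : ℝ} (hx : 0 ≤ x) (hy : 0 ≤ y)
    (hA : (energy id A : ℝ) ≤ x ^ 4) (hB : (energy id B : ℝ) ≤ y ^ 4) :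
    (energy id (A ∪ B) : ℝ) ≤ (x + y) ^ 4 := by
  set U := (A ∪ B) + (A ∪ B) with hU
  have hAB : (Finset.addEnergy A B : ℝ) ≤ (x * y) ^ 2 := by
    refine abs_le_of_sq_le_sq' ?_ (by positivity) |>.2
    calc (Finset.addEnergy A B : ℝ) ^ 2 ≤ energy id A * energy id B := by
          exact_mod_cast addEnergy_sq_le A B
      _ ≤ x ^ 4 * y ^ 4 := mul_le_mul hA hB (Nat.cast_nonneg _) (by positivity)
      _ = _ := by ring
  set r := fun s => (sumRep A A s : ℝ)
  set t := fun s => (sumRep A B s : ℝ)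
  set u := fun s => (sumRep B B s : ℝ)
  have h1 : ∑ s ∈ U, r s ^ 2 ≤ (x ^ 2) ^ 2 := by
    have := addEnergy_eq_sum_sumRep_sq A A U (add_subset_add subset_union_left subset_union_left)
    change energy id A = _ at this
    rw [this] at hA
    push_cast at hA
    linarith [hA, pow_mul x 2 2]
  have h2 : ∑ s ∈ U, t s ^ 2 ≤ (x * y) ^ 2 := by
    have := addEnergy_eq_sum_sumRep_sq A B U (add_subset_add subset_union_left subset_union_right)
    rw [this] at hAB
    push_cast at hAB
    exact hAB
  have h3 : ∑ s ∈ U, u s ^ 2 ≤ (y ^ 2) ^ 2 := by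
    have := addEnergy_eq_sum_sumRep_sq B B U (add_subset_add subset_union_right subset_union_right)
    change energy id B = _ at this
    rw [this] at hB
    push_cast at hB
    linarith [hB, pow_mul y 2 2]
  have h12 := sum_mul_le_of_sum_sq_le U r t (by positivity) (by positivity) h1 h2
  have h13 := sum_mul_le_of_sum_sq_le U r u (by positivity) (by positivity) h1 h3
  have h23 := sum_mul_le_of_sum_sq_le U t u (by positivity) (by positivity) h2 h3
  have hE : (energy id (A ∪ B) : ℝ) = ∑ s ∈ U, (sumRep (A ∪ B) (A ∪ B) s : ℝ) ^ 2 := by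
    exact_mod_cast addEnergy_eq_sum_sumRep_sq (A ∪ B) (A ∪ B) U subset_rfl
  calc (energy id (A ∪ B) : ℝ) = ∑ s ∈ U, (sumRep (A ∪ B) (A ∪ B) s : ℝ) ^ 2 := hE
    _ ≤ ∑ s ∈ U, (r s + 2 * t s + u s) ^ 2 := by
      refine sum_le_sum fun s _ => pow_le_pow_left₀ (Nat.cast_nonneg _) ?_ 2
      simp only [r, t, u]
      exact_mod_cast sumRep_union_le A B s
    _ = ∑ s ∈ U, r s ^ 2 + 4 * ∑ s ∈ U, t s ^ 2 + ∑ s ∈ U, u s ^ 2 + 4 * ∑ s ∈ U, r s * t s +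
        2 * ∑ s ∈ U, r s * u s + 4 * ∑ s ∈ U, t s * u s := by
      simp only [mul_sum, ← sum_add_distrib]
      exact sum_congr rfl fun s _ => by ring
    _ ≤ (x + y) ^ 4 := by nlinarith

end Subadditivity

lemma energy_le_of_subset_of_card (f : ℂ → ℂ) {B B' : Finset ℂ} {p : ℕ} (hB : B' ⊆ B)
    (hcard : #B ≤ 160 * #B') (hE : 2560 * energy f B ≤ #B * p ^ 3) :
    16 * energy f B' ≤ #B' * p ^ 3 := by
  have h1 := energy_mono f hB
  have h2 := Nat.mul_le_mul_right (p ^ 3) hcard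
  nlinarith

lemma exists_sidonFor_of_energy_le (B : Finset ℂ) {f₁ f₂ : ℂ → ℂ} (hf₁ : Set.InjOn f₁ B)
    (hf₂ : Set.InjOn f₂ B) {N L : ℕ} {Y : ℝ} (hY : 1 ≤ Y) (hN : (N : ℝ) = Y ^ 48) (hL : 1 ≤ L)
    (hNB : N ≤ 8 * #B) (hBN : #B ≤ N) (hE : (energy f₂ B : ℝ) ≤ 12 ^ 4 * L ^ 8 * Y ^ 132) :
    ∃ S ⊆ B, SidonFor f₁ S ∧ SidonFor f₂ S ∧ Y ^ 20 ≤ 15421440 * L ^ 3 * #S := by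
  have hL' : (1 : ℝ) ≤ L := by exact_mod_cast hL
  have hY0 : 0 < Y := by linarith
  set Q : ℝ := 752 * Y ^ 28 * L ^ 3 with hQ
  have hYL : 1 ≤ Y ^ 28 * L ^ 3 := one_le_mul_of_one_le_of_one_le (one_le_pow₀ hY) (one_le_pow₀ hL')
  have hQ1 : 752 ≤ Q := by rw [hQ]; nlinarith
  have hP0 : 752 ≤ ⌈Q⌉₊ := by exact_mod_cast hQ1.trans (Nat.le_ceil Q)
  obtain ⟨p, hp, hPp, hpP⟩ := Nat.exists_prime_lt_and_le_two_mul ⌈Q⌉₊ (by omega)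
  have : Fact p.Prime := ⟨hp⟩
  have hQp : Q ≤ p := (Nat.le_ceil Q).trans (by exact_mod_cast hPp.le)
  have hpQ : (p : ℝ) ≤ 1506 * (Y ^ 28 * L ^ 3) := by
    have h1 : (p : ℝ) ≤ 2 * (⌈Q⌉₊ : ℝ) := by exact_mod_cast hpP
    have h2 := Nat.ceil_lt_add_one (show 0 ≤ Q by linarith)
    rw [hQ] at h2 h1
    nlinarith
  have hNB' : Y ^ 48 ≤ 8 * (#B : ℝ) := by rw [← hN]; exact_mod_cast hNB
  have hBN' : (#B : ℝ) ≤ Y ^ 48 := by rw [← hN]; exact_mod_cast hBN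
  have hpB : 32 * #B ≤ p ^ 2 := by
    have : (32 * #B : ℝ) ≤ p ^ 2 := by
      calc (32 * #B : ℝ) ≤ 32 * Y ^ 48 := by linarith
        _ ≤ 752 ^ 2 * (Y ^ 48 * Y ^ 8 * (L ^ 3) ^ 2) := by
          have : 1 ≤ Y ^ 8 * ((L : ℝ) ^ 3) ^ 2 := one_le_mul_of_one_le_of_one_le (one_le_pow₀ hY)
            (one_le_pow₀ (one_le_pow₀ hL'))
          have := mul_le_mul_of_nonneg_left this (show 0 ≤ Y ^ 48 by positivity)
          nlinarith [show 0 < Y ^ 48 by positivity]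
        _ = Q ^ 2 := by rw [hQ]; ring
        _ ≤ p ^ 2 := by gcongr
    exact_mod_cast this
  have hpE : 2560 * energy f₂ B ≤ #B * p ^ 3 := by
    have : (2560 * energy f₂ B : ℝ) ≤ #B * p ^ 3 := by
      calc (2560 * energy f₂ B : ℝ) ≤ 2560 * (12 ^ 4 * L ^ 8 * Y ^ 132) := by linarith
        _ ≤ 2560 * (12 ^ 4 * L ^ 9 * Y ^ 132) := by
          gcongr
          norm_num
        _ ≤ Y ^ 48 / 8 * Q ^ 3 := by
          rw [hQ]
          have : 0 ≤ (L : ℝ) ^ 9 * Y ^ 132 := by positivity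
          nlinarith
        _ ≤ #B * p ^ 3 := by
          gcongr
          linarith
    exact_mod_cast this
  obtain ⟨B', hB', hcard, g, hg, hfg⟩ :=
    exists_freiman_embedding B f₁ hf₁ hp.pos (by omega)
  obtain ⟨S, hS, hSc, hS₁, hS₂⟩ := exists_sidonFor_of_embedding (by omega) B' f₁ f₂
    (hf₂.mono (coe_subset.2 hB')) g hg hfg
    ((Nat.mul_le_mul_left _ (card_le_card hB')).trans hpB)
    (energy_le_of_subset_of_card f₂ hB' hcard hpE)
  refine ⟨S, hS.trans hB', hS₁, hS₂, ?_⟩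
  have h1 : (#B : ℝ) ≤ 160 * (8 * p * #S) := by
    exact_mod_cast hcard.trans (Nat.mul_le_mul_left _ hSc)
  have h2 : Y ^ 28 * Y ^ 20 ≤ Y ^ 28 * (15421440 * L ^ 3 * #S) := by
    calc Y ^ 28 * Y ^ 20 = Y ^ 48 := by ring
      _ ≤ 8 * (160 * (8 * (p : ℝ) * #S)) := by linarith
      _ ≤ 8 * (160 * (8 * (1506 * (Y ^ 28 * L ^ 3)) * #S)) := by gcongr
      _ = _ := by ring
  exact le_of_mul_le_mul_left h2 (by positivity)

/-- Every set has a large subset that has either small additive energy or small energy with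
respect to `f`. -/
lemma exists_subset_energy_le (f : ℂ → ℂ) (A : Finset ℂ) (h0 : ∀ a ∈ A, a ≠ 0)
    (hf : ∀ a ∈ A, ∀ b ∈ A, ∀ c ∈ A, ∀ d ∈ A, f a + f b = f c + f d → a * b = c * d)
    {N : ℕ} {Y : ℝ} (hY : 1 ≤ Y) (hN : (N : ℝ) = Y ^ 48) (hAN : #A ≤ N) :
    ∃ B ⊆ A, #A ≤ 2 * #B ∧
      ((energy id B : ℝ) ≤ 12 ^ 4 * (Nat.log 2 N + 1 : ℕ) ^ 8 * Y ^ 132 ∨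
        (energy f B : ℝ) ≤ 12 ^ 4 * (Nat.log 2 N + 1 : ℕ) ^ 8 * Y ^ 132) := by
  set L := Nat.log 2 N + 1 with hLdef
  have hL : (1 : ℝ) ≤ L := by exact_mod_cast Nat.le_add_left 1 _
  have hY0 : 0 < Y := by linarith
  set r : ℝ := 12 * L ^ 2 / Y ^ 15 with hr
  have hr0 : 0 ≤ r := by positivity
  obtain ⟨B, hBm, hmax⟩ := exists_max_image
    (A.powerset.filter fun B => (energy id B : ℝ) ≤ (r * #B) ^ 4) card
    ⟨∅, by simp [energy]⟩
  rw [mem_filter, mem_powerset] at hBm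
  obtain ⟨hBA, hBE⟩ := hBm
  by_cases hBc : #A ≤ 2 * #B
  · refine ⟨B, hBA, hBc, Or.inl (hBE.trans ?_)⟩
    have hBN : (#B : ℝ) ≤ Y ^ 48 := by
      rw [← hN]; exact_mod_cast (card_le_card hBA).trans hAN
    calc (r * #B) ^ 4 ≤ (r * Y ^ 48) ^ 4 := by gcongr
      _ = _ := by rw [hr]; field_simp
  have hcard : #(A \ B) + #B = #A := card_sdiff_add_card_eq_card hBA
  refine ⟨A \ B, sdiff_subset, by omega, Or.inr ?_⟩
  by_contra! hlt
  have hlt' : Y ^ 132 ≤ energy f (A \ B) := by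
    refine le_trans ?_ hlt.le
    have : (1 : ℝ) ≤ L ^ 8 := one_le_pow₀ hL
    nlinarith [show 0 < Y ^ 132 by positivity]
  obtain ⟨C, hC, hCne, hCE⟩ := exists_subset_energy_mul_le f (A \ B) (card_pos.1 (by omega))
    (fun a ha => h0 a (sdiff_subset ha))
    (fun a ha b hb c hc d hd => hf a (sdiff_subset ha) b (sdiff_subset hb) c (sdiff_subset hc) d
      (sdiff_subset hd))
  have hCE' : (energy id C : ℝ) ≤ (r * #C) ^ 4 := by
    refine abs_le_of_sq_le_sq' ?_ (by positivity) |>.2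
    have hle : #(A \ B) ≤ N := by omega
    have hlog : Nat.log 2 #(A \ B) + 1 ≤ L := Nat.add_le_add_right (Nat.log_mono_right hle) 1
    have hle' : (#(A \ B) : ℝ) ≤ Y ^ 48 := by rw [← hN]; exact_mod_cast hle
    have h1 : (energy id C : ℝ) ^ 2 * energy f (A \ B) ^ 2 ≤
        2 ^ 28 * (Nat.log 2 #(A \ B) + 1 : ℕ) ^ 11 * #(A \ B) ^ 3 * #C ^ 8 := by
      exact_mod_cast hCE
    have h2 : (energy id C : ℝ) ^ 2 * Y ^ 264 ≤ (r * #C) ^ 8 * Y ^ 264 := by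
      calc (energy id C : ℝ) ^ 2 * Y ^ 264 = (energy id C : ℝ) ^ 2 * (Y ^ 132) ^ 2 := by ring
        _ ≤ (energy id C : ℝ) ^ 2 * energy f (A \ B) ^ 2 := by gcongr
        _ ≤ _ := h1
        _ ≤ 2 ^ 28 * (L : ℝ) ^ 11 * (Y ^ 48) ^ 3 * #C ^ 8 := by gcongr
        _ ≤ 12 ^ 8 * (L : ℝ) ^ 16 * (Y ^ 48) ^ 3 * #C ^ 8 := by
          gcongr
          · norm_num
          · norm_num
        _ = _ := by rw [hr]; field_simp
    calc (energy id C : ℝ) ^ 2 ≤ (r * #C) ^ 8 := le_of_mul_le_mul_right h2 (by positivity)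
      _ = _ := by ring
  have hdisj : Disjoint B C := disjoint_of_subset_right hC disjoint_sdiff
  have hunion : #(B ∪ C) = #B + #C := card_union_of_disjoint hdisj
  have := hmax (B ∪ C) (mem_filter.2 ⟨mem_powerset.2 (union_subset hBA (hC.trans sdiff_subset)), by
    refine (energy_union_le B C (by positivity) (by positivity) hBE hCE').trans_eq ?_
    rw [hunion]
    push_cast
    ring⟩)
  have := hCne.card_pos
  omega

/-- On a half-plane, the complex logarithm turns products into sums. -/
lemma log_add_log_eq_iff {A : Finset ℂ} (h0 : ∀ a ∈ A, a ≠ 0)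
    (harg : (∀ a ∈ A, 0 < a.arg) ∨ ∀ a ∈ A, a.arg ≤ 0) {a b c d : ℂ} (ha : a ∈ A) (hb : b ∈ A)
    (hc : c ∈ A) (hd : d ∈ A) :
    Complex.log a + Complex.log b = Complex.log c + Complex.log d ↔ a * b = c * d := by
  have hexp : ∀ x ∈ A, ∀ y ∈ A, Complex.exp (Complex.log x + Complex.log y) = x * y := by
    intro x hx y hy
    rw [Complex.exp_add, Complex.exp_log (h0 x hx), Complex.exp_log (h0 y hy)]
  constructor
  · intro h
    rw [← hexp a ha b hb, h, hexp c hc d hd]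
  · intro h
    rw [← hexp a ha b hb, ← hexp c hc d hd, Complex.exp_eq_exp_iff_exists_int] at h
    obtain ⟨n, hn⟩ := h
    have him := congrArg Complex.im hn
    simp only [Complex.add_im, Complex.log_im, Complex.mul_im, Complex.intCast_re,
      Complex.intCast_im, Complex.mul_re, Complex.I_re, Complex.I_im, Complex.ofReal_re,
      Complex.ofReal_im, Complex.re_ofNat, Complex.im_ofNat] at him
    have hpi := Real.pi_pos
    have bound : |a.arg + b.arg - (c.arg + d.arg)| < 2 * Real.pi := by
      rcases harg with h | h
      · rw [abs_lt]
        constructor <;> linarith [h a ha, h b hb, h c hc, h d hd, a.arg_le_pi, b.arg_le_pi,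
          c.arg_le_pi, d.arg_le_pi]
      · rw [abs_lt]
        constructor <;> linarith [h a ha, h b hb, h c hc, h d hd, a.neg_pi_lt_arg,
          b.neg_pi_lt_arg, c.neg_pi_lt_arg, d.neg_pi_lt_arg]
    have hn0 : n = 0 := by
      have h1 : a.arg + b.arg - (c.arg + d.arg) = n * (2 * Real.pi) := by linarith
      rw [h1, abs_mul, abs_of_pos (by positivity : 0 < 2 * Real.pi)] at bound
      have h2 : |(n : ℝ)| < 1 := by
        by_contra! h
        nlinarith
      exact Int.abs_lt_one_iff.1 (by exact_mod_cast h2)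
    rw [hn, hn0]
    simp

/-- A positive proportion of a set of complex numbers lies in a half-plane and avoids `0`. -/
lemma exists_subset_halfPlane (A : Finset ℂ) (hA : 2 ≤ #A) :
    ∃ B ⊆ A, #A ≤ 4 * #B ∧ (∀ a ∈ B, a ≠ 0) ∧
      ((∀ a ∈ B, 0 < a.arg) ∨ ∀ a ∈ B, a.arg ≤ 0) := by
  have h1 := card_filter_add_card_filter_not (s := A.erase 0) (fun a : ℂ => 0 < a.arg)
  have h2 := pred_card_le_card_erase (s := A) (a := (0 : ℂ))
  rcases le_total #{a ∈ A.erase 0 | 0 < a.arg} #{a ∈ A.erase 0 | ¬ 0 < a.arg} with h | h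
  · exact ⟨_, (filter_subset _ _).trans (erase_subset _ _), by omega,
      fun a ha => ne_of_mem_erase (mem_filter.1 ha).1,
      Or.inr fun a ha => not_lt.1 (mem_filter.1 ha).2⟩
  · exact ⟨_, (filter_subset _ _).trans (erase_subset _ _), by omega,
      fun a ha => ne_of_mem_erase (mem_filter.1 ha).1,
      Or.inl fun a ha => (mem_filter.1 ha).2⟩

lemma exists_sidonFor_id_log (A : Finset ℂ) (hA : 2 ≤ #A) {Y : ℝ} (hY : 1 ≤ Y)
    (hAY : (#A : ℝ) = Y ^ 48) :
    ∃ S ⊆ A, (∀ a ∈ S, ∀ b ∈ S, ∀ c ∈ S, ∀ d ∈ S, a * b = c * d →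
        Complex.log a + Complex.log b = Complex.log c + Complex.log d) ∧
      SidonFor id S ∧ SidonFor Complex.log S ∧
      Y ^ 20 ≤ 15421440 * (Nat.log 2 #A + 1 : ℕ) ^ 3 * #S := by
  obtain ⟨A₀, hA₀, hcard, h0, harg⟩ := exists_subset_halfPlane A hA
  have hiff := fun {a b c d : ℂ} => log_add_log_eq_iff (a := a) (b := b) (c := c) (d := d) h0 harg
  have hinj : Set.InjOn Complex.log (A₀ : Set ℂ) := fun a ha b hb h => by
    rw [← Complex.exp_log (h0 a ha), h, Complex.exp_log (h0 b hb)]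
  obtain ⟨B, hB, hBc, hE⟩ := exists_subset_energy_le Complex.log A₀ h0
    (fun a ha b hb c hc d hd h => (hiff ha hb hc hd).1 h) hY hAY (card_le_card hA₀)
  have hlog := hinj.mono (coe_subset.2 hB)
  have hid : Set.InjOn (id : ℂ → ℂ) (B : Set ℂ) := Function.injective_id.injOn
  have hBA := card_le_card (hB.trans hA₀)
  obtain ⟨S, hS, hS₁, hS₂, hSc⟩ : ∃ S ⊆ B, SidonFor id S ∧ SidonFor Complex.log S ∧
      Y ^ 20 ≤ 15421440 * (Nat.log 2 #A + 1 : ℕ) ^ 3 * #S := by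
    rcases hE with hE | hE
    · obtain ⟨S, hS, hS₁, hS₂, hSc⟩ := exists_sidonFor_of_energy_le B hlog hid hY hAY
        (Nat.le_add_left 1 _) (by omega) hBA hE
      exact ⟨S, hS, hS₂, hS₁, hSc⟩
    · exact exists_sidonFor_of_energy_le B hid hlog hY hAY
        (Nat.le_add_left 1 _) (by omega) hBA hE
  exact ⟨S, hS.trans (hB.trans hA₀), fun a ha b hb c hc d hd h =>
    (hiff (hB (hS ha)) (hB (hS hb)) (hB (hS hc)) (hB (hS hd))).2 h, hS₁, hS₂, hSc⟩

lemma natLog_two_add_one_le {n : ℕ} (hn : 2 ≤ n) :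
    ((Nat.log 2 n + 1 : ℕ) : ℝ) ≤ 4 * Real.log n := by
  have h1 : ((2 : ℝ)) ^ Nat.log 2 n ≤ n := by exact_mod_cast Nat.pow_log_le_self 2 (by omega)
  have h2 := Real.log_le_log (by positivity) h1
  rw [Real.log_pow] at h2
  have h3 := Real.log_le_log (by norm_num) (show (2 : ℝ) ≤ n by exact_mod_cast hn)
  have h4 := Real.log_two_gt_d9
  have h5 : (0 : ℝ) ≤ Nat.log 2 n := Nat.cast_nonneg _
  push_cast
  nlinarith

end Auxiliary

theorem bi_sidon_complex :
    ∃ c > (0 : ℝ), ∃ C ≥ (0 : ℝ), ∀ A : Finset ℂ, 2 ≤ A.card →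
      ∃ S ⊆ A, IsBiSidon (S : Set ℂ) ∧
        c * (A.card : ℝ) ^ ((5 : ℝ) / 12) * (Real.log A.card) ^ (-C) ≤ S.card := by
  refine ⟨1 / (15421440 * 64), by norm_num, 3, by norm_num, fun A hA => ?_⟩
  have hA' : (2 : ℝ) ≤ A.card := by exact_mod_cast hA
  have hlog : 0 < Real.log A.card := Real.log_pos (by linarith)
  obtain ⟨S, hSA, hmul, hS₁, hS₂, hSc⟩ := exists_sidonFor_id_log A hA
    (Y := (A.card : ℝ) ^ ((1 : ℝ) / 48)) (Real.one_le_rpow (by linarith) (by norm_num)) (by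
      rw [← Real.rpow_natCast, ← Real.rpow_mul (by linarith)]; norm_num)
  refine ⟨S, hSA, ⟨?_, ?_⟩, ?_⟩
  · intro a ha b hb c hc d hd h
    rcases hS₁ a ha b hb c hc d hd h with ⟨rfl, rfl⟩ | ⟨rfl, rfl⟩
    · rfl
    · exact Set.pair_comm _ _
  · intro a ha b hb c hc d hd h
    rcases hS₂ a ha b hb c hc d hd (hmul a ha b hb c hc d hd h) with ⟨rfl, rfl⟩ | ⟨rfl, rfl⟩
    · rfl
    · exact Set.pair_comm _ _
  · have hpow : ((A.card : ℝ) ^ ((1 : ℝ) / 48)) ^ 20 = (A.card : ℝ) ^ ((5 : ℝ) / 12) := by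
      rw [← Real.rpow_natCast, ← Real.rpow_mul (by linarith)]; norm_num
    rw [hpow] at hSc
    have h3 : Real.log A.card ^ (-(3 : ℝ)) = (Real.log A.card ^ 3)⁻¹ := by
      rw [Real.rpow_neg hlog.le]
      norm_cast
    rw [h3, ← div_eq_mul_inv, div_le_iff₀ (by positivity)]
    have h4 : ((Nat.log 2 A.card + 1 : ℕ) : ℝ) ^ 3 ≤ 64 * Real.log A.card ^ 3 := by
      calc ((Nat.log 2 A.card + 1 : ℕ) : ℝ) ^ 3 ≤ (4 * Real.log A.card) ^ 3 :=
            pow_le_pow_left₀ (Nat.cast_nonneg _) (natLog_two_add_one_le hA) 3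
        _ = _ := by ring
    have h5 := mul_le_mul_of_nonneg_right h4 (Nat.cast_nonneg (α := ℝ) S.card)
    linarith
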